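/- arXiv:1403.2235 — 9 statements merged into one kernel-verified Lean document; each statement's English description precedes it below -/
import Mathlib

section
/- Let λ > 1 and δ ≠ 0 be real numbers. Let f be a C^∞ function on [1,λ] such that for every integer n ≥ 0 one has f⁽ⁿ⁾(1) = f⁽ⁿ⁾(λ) = 0. Then f extends in a unique way to a C^∞ function on [0,∞) that is a solution of the integral equation (E_{λ,δ}). -/
open MeasureTheory

/-- `f` is a solution of the integral equation `(E_{λ,δ})` on `[0,∞)`:
it is continuous on `[0,∞)` and `∫₀^{λx} f = δ (f x - f 0)` for all `x ≥ 0`. -/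
def IsSolution (lam δ : ℝ) (f : ℝ → ℝ) : Prop :=
  ContinuousOn f (Set.Ici 0) ∧
  ∀ x : ℝ, 0 ≤ x → (∫ t in (0:ℝ)..(lam * x), f t) = δ * (f x - f 0)

open Set Filter Topology

/-- Solutions satisfy the functional differential equation on `(0,∞)`. -/
lemma sol_hasDerivAt {lam δ : ℝ} (hlam : 1 < lam) (hδ : δ ≠ 0) {g : ℝ → ℝ}
    (hg : IsSolution lam δ g) {x : ℝ} (hx : 0 < x) :
    HasDerivAt g (lam / δ * g (lam * x)) x := by
  obtain ⟨hc, he⟩ := hg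
  have hl0 : 0 < lam := by linarith
  have hlx : 0 < lam * x := by positivity
  have hint : IntervalIntegrable g volume 0 (lam * x) := by
    apply ContinuousOn.intervalIntegrable
    rw [uIcc_of_le hlx.le]
    exact hc.mono Icc_subset_Ici_self
  have hca : ContinuousAt g (lam * x) := hc.continuousAt (Ici_mem_nhds hlx)
  have hsm : StronglyMeasurableAtFilter g (𝓝 (lam * x)) volume :=
    (hc.mono Ioi_subset_Ici_self).stronglyMeasurableAtFilter isOpen_Ioi _ hlx
  have h1 := intervalIntegral.integral_hasDerivAt_right hint hsm hca
  have h2 : HasDerivAt (fun y : ℝ => lam * y) lam x := by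
    simpa using (hasDerivAt_id x).const_mul lam
  have h3 := (h1.comp x h2).const_mul (1 / δ) |>.add_const (g 0)
  have h4 : HasDerivAt g (1 / δ * (g (lam * x) * lam)) x := by
    refine h3.congr_of_eventuallyEq ?_
    filter_upwards [Ioi_mem_nhds hx] with y hy
    have := he y (le_of_lt hy)
    simp only [Function.comp]
    rw [this]; field_simp; ring
  refine h4.congr_deriv ?_
  ring

lemma uniq_zero {lam c : ℝ} (hlam : 1 < lam) (hc : c ≠ 0) {h : ℝ → ℝ}
    (hcont : ContinuousOn h (Ici 0))
    (hd : ∀ x, 0 < x → HasDerivAt h (c * h (lam * x)) x)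
    (h0 : ∀ x ∈ Icc 1 lam, h x = 0) : ∀ x ∈ Ici (0:ℝ), h x = 0 := by
  have hl0 : 0 < lam := by linarith
  have up : ∀ n : ℕ, ∀ x ∈ Icc 1 (lam ^ (n+1)), h x = 0 := by
    intro n
    induction n with
    | zero => simpa using h0
    | succ n ih =>
      intro y hy
      by_cases hyl : y ≤ lam
      · exact h0 y ⟨hy.1, hyl⟩
      push Not at hyl
      have hx1 : 1 < y / lam := by rwa [one_lt_div hl0]
      have hx2 : y / lam ≤ lam ^ (n+1) := by
        rw [div_le_iff₀ hl0, ← pow_succ]; exact hy.2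
      have hmem : y / lam ∈ Icc 1 (lam ^ (n+1)) := ⟨hx1.le, hx2⟩
      have d1 := (hd (y / lam) (by linarith)).hasDerivWithinAt (s := Icc 1 (lam ^ (n+1)))
      have d2 : HasDerivWithinAt h 0 (Icc 1 (lam ^ (n+1))) (y / lam) :=
        (hasDerivWithinAt_const (y / lam) _ (0:ℝ)).congr ih (ih _ hmem)
      have hu := (uniqueDiffOn_Icc (lt_of_lt_of_le hx1 hx2)) _ hmem
      have := hu.eq_deriv _ d1 d2
      rw [mul_div_cancel₀ _ hl0.ne'] at this
      simpa [hc] using this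
  have down : ∀ n : ℕ, ∀ x, 1 / lam ^ n ≤ x → h x = 0 := by
    intro n
    induction n with
    | zero =>
      intro x hx
      obtain ⟨n, hn⟩ := pow_unbounded_of_one_lt x hlam
      refine up n x ⟨by simpa using hx, hn.le.trans ?_⟩
      exact pow_le_pow_right₀ hlam.le (by omega)
    | succ n ih =>
      intro x hx
      have hxp : 0 < x := lt_of_lt_of_le (by positivity) hx
      rcases le_total 1 x with h1 | h1
      · exact ih x (le_trans (by rw [div_le_one (by positivity)]; exact one_le_pow₀ hlam.le) h1)
      have key : ∀ t ∈ Icc x 1, h t = h x := by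
        refine constant_of_has_deriv_right_zero
          (hcont.mono fun t ht => hxp.le.trans ht.1) ?_
        intro t ht
        have htp : 0 < t := lt_of_lt_of_le hxp ht.1
        have h3 : h (lam * t) = 0 := by
          apply ih
          have : 1 / lam ^ (n+1) ≤ t := hx.trans ht.1
          rw [div_le_iff₀ (by positivity)] at this ⊢
          calc 1 ≤ _ := this
            _ = _ := by ring
        have := (hd t htp).hasDerivWithinAt (s := Ici t)
        rwa [h3, mul_zero] at this
      rw [← key 1 ⟨h1, le_rfl⟩]
      exact h0 1 ⟨le_rfl, hlam.le⟩
  have pos : ∀ x ∈ Ioi (0:ℝ), h x = 0 := by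
    intro x hx
    obtain ⟨n, hn⟩ := pow_unbounded_of_one_lt (1 / x) hlam
    apply down n
    rw [div_le_iff₀ (by positivity)]
    rw [div_lt_iff₀ hx] at hn
    linarith [mul_comm x (lam ^ n)]
  have : EqOn h (fun _ => 0) (Ici 0) := by
    rw [← closure_Ioi]
    refine EqOn.of_subset_closure (s := Ioi 0) (t := closure (Ioi 0)) pos (by simpa using hcont) continuousOn_const
      subset_closure subset_rfl
  exact this

lemma hasDerivWithinAt_of_notMem_closure' {f : ℝ → ℝ} {f' x : ℝ} {s : Set ℝ}
    (h : x ∉ closure s) : HasDerivWithinAt f f' s x := by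
  rw [hasDerivWithinAt_iff_hasFDerivWithinAt]
  exact HasFDerivWithinAt.of_notMem_closure h

/-- Zero extension of the iterated derivatives. -/
noncomputable def zext (lam : ℝ) (f : ℝ → ℝ) (n : ℕ) : ℝ → ℝ :=
  (Icc 1 lam).indicator (iteratedDerivWithin n f (Icc 1 lam))

lemma zext_left {lam : ℝ} {f : ℝ → ℝ}
    (h1 : ∀ n : ℕ, iteratedDerivWithin n f (Set.Icc 1 lam) 1 = 0) (n : ℕ) {x : ℝ} (hx : x ≤ 1) :
    zext lam f n x = 0 := by
  rcases hx.eq_or_lt with rfl | hx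
  · unfold zext
    rw [indicator_apply_eq_zero]
    exact fun _ => h1 n
  · exact indicator_of_notMem (fun h => absurd h.1 (not_le.2 hx)) _

lemma zext_right {lam : ℝ} {f : ℝ → ℝ}
    (h2 : ∀ n : ℕ, iteratedDerivWithin n f (Set.Icc 1 lam) lam = 0) (n : ℕ) {x : ℝ}
    (hx : lam ≤ x) : zext lam f n x = 0 := by
  rcases hx.eq_or_lt with rfl | hx
  · unfold zext
    rw [indicator_apply_eq_zero]
    exact fun _ => h2 n
  · exact indicator_of_notMem (fun h => absurd h.2 (not_le.2 hx)) _

lemma zext_hasDerivAt {lam : ℝ} (hlam : 1 < lam) {f : ℝ → ℝ}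
    (hf : ContDiffOn ℝ (⊤ : ℕ∞) f (Set.Icc 1 lam))
    (h1 : ∀ n : ℕ, iteratedDerivWithin n f (Set.Icc 1 lam) 1 = 0)
    (h2 : ∀ n : ℕ, iteratedDerivWithin n f (Set.Icc 1 lam) lam = 0) (n : ℕ) (x : ℝ) :
    HasDerivAt (zext lam f n) (zext lam f (n+1) x) x := by
  have hl : HasDerivWithinAt (zext lam f n) (zext lam f (n+1) x) (Iic 1) x := by
    by_cases hx : x ≤ 1
    · rw [zext_left h1 (n+1) hx]
      exact (hasDerivWithinAt_const x _ (0:ℝ)).congr (fun y hy => zext_left h1 n hy)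
        (zext_left h1 n hx)
    · exact hasDerivWithinAt_of_notMem_closure' (by simpa using hx)
  have hr : HasDerivWithinAt (zext lam f n) (zext lam f (n+1) x) (Ici lam) x := by
    by_cases hx : lam ≤ x
    · rw [zext_right h2 (n+1) hx]
      exact (hasDerivWithinAt_const x _ (0:ℝ)).congr (fun y hy => zext_right h2 n hy)
        (zext_right h2 n hx)
    · exact hasDerivWithinAt_of_notMem_closure' (by simpa using hx)
  have hm : HasDerivWithinAt (zext lam f n) (zext lam f (n+1) x) (Icc 1 lam) x := by
    by_cases hx : x ∈ Icc 1 lam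
    · have hdiff : DifferentiableOn ℝ (iteratedDerivWithin n f (Icc 1 lam)) (Icc 1 lam) :=
        hf.differentiableOn_iteratedDerivWithin (by exact_mod_cast WithTop.coe_lt_top (n : ℕ)) (uniqueDiffOn_Icc hlam)
      have h3 := (hdiff x hx).hasDerivWithinAt
      rw [← iteratedDerivWithin_succ] at h3
      have e : zext lam f (n+1) x = iteratedDerivWithin (n+1) f (Icc 1 lam) x :=
        indicator_of_mem hx _
      rw [e]
      exact h3.congr (fun y hy => indicator_of_mem hy _) (indicator_of_mem hx _)
    · exact hasDerivWithinAt_of_notMem_closure' (by rwa [isClosed_Icc.closure_eq])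
  have := (hl.union hm).union hr
  rw [Iic_union_Icc_eq_Iic hlam.le, Iic_union_Ici] at this
  exact hasDerivWithinAt_univ.1 this

/-- Forward part. -/
lemma forward {lam c : ℝ} (hlam : 1 < lam) (hc : c ≠ 0) (D : ℕ → ℝ → ℝ)
    (hD : ∀ n x, HasDerivAt (D n) (D (n+1) x) x) (hz : ∀ n x, x ≤ 1 → D n x = 0) :
    ∃ p : ℝ → ℝ, (∀ x, HasDerivAt p (c * (p (lam * x) - D 0 (lam * x))) x) ∧
      ∀ x ≤ lam, p x = D 0 x := by
  have hl0 : 0 < lam := by linarith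
  let a : ℕ → ℝ := fun n => ∏ i ∈ Finset.range n, 1 / (c * lam ^ i)
  let F : ℕ → ℝ → ℝ := fun n x => a n * D n (x / lam ^ n)
  have ha : ∀ n, a n / lam ^ n = c * a (n+1) := by
    intro n
    simp only [a, Finset.prod_range_succ]
    field_simp
  have hF0 : ∀ n x, x ≤ lam ^ n → F n x = 0 := by
    intro n x hx
    simp only [F]
    rw [hz n _ (by rwa [div_le_one (by positivity)]), mul_zero]
  have hFd : ∀ n x, HasDerivAt (F n) (c * F (n+1) (lam * x)) x := by
    intro n x
    have h := ((hD n (x / lam ^ n)).comp x ((hasDerivAt_id x).div_const (lam ^ n))).const_mul (a n)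
    refine h.congr_deriv ?_
    simp only [F]
    have : lam * x / lam ^ (n+1) = x / lam ^ n := by rw [pow_succ]; field_simp
    rw [this]
    linear_combination D (n+1) (x / lam ^ n) * ha n
  have hsum : ∀ N x, x ≤ lam ^ N → ∑' n, F n x = ∑ n ∈ Finset.range N, F n x := by
    intro N x hx
    apply tsum_eq_sum
    intro n hn
    apply hF0
    simp only [Finset.mem_range, not_lt] at hn
    exact hx.trans (pow_le_pow_right₀ hlam.le hn)
  refine ⟨fun x => ∑' n, F n x, ?_, ?_⟩
  · intro x
    obtain ⟨N, hN⟩ := pow_unbounded_of_one_lt x hlam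
    have h1 : HasDerivAt (fun y => ∑ n ∈ Finset.range N, F n y)
        (∑ n ∈ Finset.range N, c * F (n+1) (lam * x)) x :=
      HasDerivAt.fun_sum fun n _ => hFd n x
    have h2 := h1.congr_of_eventuallyEq (f₁ := fun x => ∑' n, F n x) (by
      filter_upwards [Iio_mem_nhds hN] with y hy
      exact hsum N y (le_of_lt hy))
    refine h2.congr_deriv ?_
    beta_reduce
    rw [hsum (N+1) (lam * x) (by rw [pow_succ, mul_comm]; gcongr), Finset.sum_range_succ',
      ← Finset.mul_sum]
    simp [F, a]
  · intro x hx
    simp only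
    rw [hsum 1 x (by simpa using hx)]
    simp [F, a]

/-- Iterated backward integrals. -/
noncomputable def bw (lam c : ℝ) (F : ℝ → ℝ) : ℕ → ℝ → ℝ
  | 0 => F
  | (n+1) => fun x => c * ∫ t in (1:ℝ)..x, bw lam c F n (lam * t)

lemma bw_cont {lam c : ℝ} {F : ℝ → ℝ} (hF : Continuous F) (n : ℕ) :
    Continuous (bw lam c F n) := by
  induction n with
  | zero => exact hF
  | succ n ih =>
    have : Continuous fun t => bw lam c F n (lam * t) := ih.comp (by fun_prop)
    exact continuous_const.mul
      (intervalIntegral.continuous_primitive (fun a b => this.intervalIntegrable a b) 1)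

lemma bw_deriv {lam c : ℝ} {F : ℝ → ℝ} (hF : Continuous F) (n : ℕ) (x : ℝ) :
    HasDerivAt (bw lam c F (n+1)) (c * bw lam c F n (lam * x)) x := by
  have : Continuous fun t => bw lam c F n (lam * t) := (bw_cont hF n).comp (by fun_prop)
  exact (this.integral_hasStrictDerivAt 1 x).hasDerivAt.const_mul c

lemma bw_zero {lam c : ℝ} (hlam : 1 < lam) {F : ℝ → ℝ} (hz : ∀ x, lam ≤ x → F x = 0) (n : ℕ) :
    ∀ x, lam ≤ lam ^ n * x → bw lam c F n x = 0 := by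
  have hl0 : 0 < lam := by linarith
  induction n with
  | zero => simpa [bw] using hz
  | succ n ih =>
    intro x hx
    have hx' : 1 ≤ lam ^ n * x := by
      rw [pow_succ'] at hx
      by_contra! h
      nlinarith
    have : ∫ t in (1:ℝ)..x, bw lam c F n (lam * t) = ∫ t in (1:ℝ)..x, (0:ℝ) := by
      apply intervalIntegral.integral_congr
      intro t ht
      apply ih
      have h1 : 1 ≤ lam ^ n := one_le_pow₀ hlam.le
      have h2 : 1 ≤ lam ^ n * t := by
        rw [mem_uIcc] at ht
        rcases ht with ht | ht
        · nlinarith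
        · exact hx'.trans (by gcongr; exact ht.1)
      nlinarith
    simp [bw, this]

lemma bw_bound {lam c B : ℝ} (hlam : 1 < lam) {F : ℝ → ℝ} (hF : Continuous F)
    (hz : ∀ x, lam ≤ x → F x = 0) (hB : ∀ x, 0 ≤ x → |F x| ≤ B) (n : ℕ) :
    ∀ x, 0 ≤ x → |bw lam c F n x| ≤ B * ∏ i ∈ Finset.range n, (|c| / lam ^ i) := by
  have hl0 : 0 < lam := by linarith
  induction n with
  | zero => simpa [bw] using hB
  | succ n ih =>
    intro x hx
    set P := B * ∏ i ∈ Finset.range n, (|c| / lam ^ i) with hP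
    have hP0 : 0 ≤ P := (abs_nonneg _).trans (ih 0 le_rfl)
    have e : B * ∏ i ∈ Finset.range (n+1), (|c| / lam ^ i) = |c| * P * (1 / lam ^ n) := by
      rw [Finset.prod_range_succ, hP]; ring
    rw [e]
    rcases le_total (1 / lam ^ n) x with h | h
    · rw [bw_zero hlam hz]
      · simp only [abs_zero]; positivity
      · rw [div_le_iff₀ (by positivity)] at h
        rw [pow_succ']
        nlinarith
    · have hd : ∀ y ∈ Icc 0 (1 / lam ^ n), HasDerivWithinAt (bw lam c F (n+1))
          (c * bw lam c F n (lam * y)) (Icc 0 (1 / lam ^ n)) y :=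
        fun y _ => (bw_deriv hF n y).hasDerivWithinAt
      have hb : ∀ y ∈ Icc 0 (1 / lam ^ n), ‖c * bw lam c F n (lam * y)‖ ≤ |c| * P := by
        intro y hy
        rw [Real.norm_eq_abs, abs_mul]
        gcongr
        exact ih _ (mul_nonneg hl0.le hy.1)
      have hm := (convex_Icc (0:ℝ) (1 / lam ^ n)).norm_image_sub_le_of_norm_hasDerivWithin_le
        hd hb (x := 1 / lam ^ n) (y := x) ⟨by positivity, le_rfl⟩ ⟨hx, h⟩
      rw [bw_zero hlam hz (n+1) (1 / lam ^ n) (by rw [pow_succ']; field_simp; rfl)] at hm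
      rw [sub_zero, Real.norm_eq_abs, Real.norm_eq_abs] at hm
      refine hm.trans ?_
      gcongr
      rw [abs_sub_comm, abs_of_nonneg (by linarith)]
      linarith

lemma summ {lam C : ℝ} (hlam : 1 < lam) (B : ℝ) :
    Summable fun n : ℕ => B * ∏ i ∈ Finset.range n, (C / lam ^ i) := by
  apply Summable.mul_left
  have ht : Tendsto (fun n : ℕ => |C / lam ^ n|) atTop (𝓝 0) := by
    have h : Tendsto (fun n : ℕ => C / lam ^ n) atTop (𝓝 0) :=
      tendsto_const_nhds.div_atTop (tendsto_pow_atTop_atTop_of_one_lt hlam)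
    simpa using h.abs
  refine summable_of_ratio_norm_eventually_le (r := 1/2) (by norm_num) ?_
  filter_upwards [ht.eventually (eventually_le_nhds (show (0:ℝ) < 1/2 by norm_num))] with n hn
  rw [Finset.prod_range_succ, norm_mul, mul_comm]
  gcongr
  exact hn

lemma backward {lam c : ℝ} (hlam : 1 < lam) {F : ℝ → ℝ} (hF : Continuous F)
    (hz : ∀ x, lam ≤ x → F x = 0) :
    ∃ u : ℝ → ℝ, ContinuousOn u (Ici 0) ∧
      (∀ x, 0 < x → HasDerivAt u (c * (u (lam * x) + F (lam * x))) x) ∧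
      ∀ x, 1 ≤ x → u x = 0 := by
  have hl0 : 0 < lam := by linarith
  obtain ⟨B, hB⟩ : ∃ B, ∀ x, 0 ≤ x → |F x| ≤ B := by
    obtain ⟨B, hB⟩ := (isCompact_Icc (a := (0:ℝ)) (b := lam)).exists_bound_of_continuousOn
      hF.continuousOn
    refine ⟨B, fun x hx => ?_⟩
    rcases le_total x lam with h | h
    · exact hB x ⟨hx, h⟩
    · rw [hz x h, abs_zero]
      exact (norm_nonneg _).trans (hB 0 ⟨le_rfl, hl0.le⟩)
  set b : ℕ → ℝ := fun n => B * ∏ i ∈ Finset.range n, (|c| / lam ^ i) with hb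
  have hbs : Summable b := summ hlam B
  have hbs1 : Summable fun n => b (n+1) := (summable_nat_add_iff 1).2 hbs
  have hbd : ∀ n x, 0 ≤ x → |bw lam c F n x| ≤ b n := bw_bound hlam hF hz hB
  have hsb : ∀ x, 0 ≤ x → Summable fun n => bw lam c F n x := fun x hx =>
    Summable.of_norm_bounded hbs fun n => hbd n x hx
  have hsb1 : ∀ x, 0 ≤ x → Summable fun n => bw lam c F (n+1) x := fun x hx =>
    (summable_nat_add_iff 1).2 (hsb x hx)
  refine ⟨fun x => ∑' n, bw lam c F (n+1) x, ?_, ?_, ?_⟩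
  · exact continuousOn_tsum (fun n => (bw_cont hF (n+1)).continuousOn) hbs1
      fun n x hx => hbd (n+1) x hx
  · intro x hx
    have h := hasDerivAt_tsum_of_isPreconnected (u := fun n => |c| * b n)
      (g := fun n => bw lam c F (n+1)) (g' := fun n y => c * bw lam c F n (lam * y))
      (t := Ioi 0) (y₀ := 1) (y := x)
      (hbs.mul_left _) isOpen_Ioi isPreconnected_Ioi (fun n y _ => bw_deriv hF n y)
      (fun n y hy => by
        rw [Real.norm_eq_abs, abs_mul]
        gcongr
        exact hbd n _ (mul_nonneg hl0.le (le_of_lt hy)))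
      (by simp) (hsb1 1 zero_le_one) hx
    refine h.congr_deriv ?_
    rw [tsum_mul_left, (hsb (lam * x) (by positivity)).tsum_eq_zero_add]
    simp only [bw]
    ring
  · intro x hx
    have : ∀ n, bw lam c F (n+1) x = 0 := by
      intro n
      apply bw_zero hlam hz
      have h1 : 1 ≤ lam ^ n := one_le_pow₀ hlam.le
      rw [pow_succ']
      have : 1 ≤ lam ^ n * x := by nlinarith
      nlinarith
    simp [this]

lemma smooth_of_eq {lam c : ℝ} (hl0 : 0 < lam) {g : ℝ → ℝ}
    (hd : ∀ x, 0 ≤ x → HasDerivWithinAt g (c * g (lam * x)) (Ici 0) x) :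
    ContDiffOn ℝ (⊤ : ℕ∞) g (Ici 0) := by
  rw [contDiffOn_infty]
  intro n
  induction n with
  | zero =>
    rw [Nat.cast_zero, contDiffOn_zero]
    exact fun x hx => (hd x hx).continuousWithinAt
  | succ n ih =>
    rw [Nat.cast_succ, contDiffOn_succ_iff_derivWithin (uniqueDiffOn_Ici 0)]
    refine ⟨fun x hx => (hd x hx).differentiableWithinAt, by simp, ?_⟩
    have : ContDiffOn ℝ n (fun x => c * g (lam * x)) (Ici 0) :=
      contDiffOn_const.mul (ih.comp (contDiff_const.mul contDiff_id).contDiffOn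
        fun x hx => mul_nonneg hl0.le hx)
    exact this.congr fun x hx => (hd x hx).derivWithin (uniqueDiffOn_Ici 0 x hx)

lemma solution_of_eq {lam δ : ℝ} (hl0 : 0 < lam) (hδ : δ ≠ 0) {g : ℝ → ℝ}
    (hd : ∀ x, 0 ≤ x → HasDerivWithinAt g (lam / δ * g (lam * x)) (Ici 0) x) :
    IsSolution lam δ g := by
  have hc : ContinuousOn g (Ici 0) := fun x hx => (hd x hx).continuousWithinAt
  refine ⟨hc, fun x hx => ?_⟩
  have hc2 : ContinuousOn (fun t => lam / δ * g (lam * t)) (Icc 0 x) :=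
    continuousOn_const.mul (hc.comp (by fun_prop) fun t ht => mul_nonneg hl0.le ht.1)
  have h := intervalIntegral.integral_eq_sub_of_hasDeriv_right_of_le hx
    (hc.mono Icc_subset_Ici_self)
    (fun t ht => (hd t ht.1.le).mono (fun s hs => ht.1.le.trans (le_of_lt hs)))
    (hc2.intervalIntegrable_of_Icc hx)
  rw [← h, intervalIntegral.integral_const_mul, intervalIntegral.integral_comp_mul_left _ hl0.ne']
  simp only [mul_zero, smul_eq_mul]
  field_simp

/-- **Theorem 1 (prolongement).** A smooth function on `[1,λ]` all of whose derivatives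
vanish at `1` and at `λ` extends uniquely to a smooth function on `[0,∞)` that is a
solution of the integral equation `(E_{λ,δ})`. -/
theorem extension_unique_solution (lam δ : ℝ) (hlam : 1 < lam) (hδ : δ ≠ 0)
    (f : ℝ → ℝ) (hf : ContDiffOn ℝ (⊤ : ℕ∞) f (Set.Icc 1 lam))
    (h1 : ∀ n : ℕ, iteratedDerivWithin n f (Set.Icc 1 lam) 1 = 0)
    (h2 : ∀ n : ℕ, iteratedDerivWithin n f (Set.Icc 1 lam) lam = 0) :
    ∃ g : ℝ → ℝ,
      (ContDiffOn ℝ (⊤ : ℕ∞) g (Set.Ici 0) ∧ Set.EqOn g f (Set.Icc 1 lam) ∧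
        IsSolution lam δ g) ∧
      ∀ g' : ℝ → ℝ,
        (ContDiffOn ℝ (⊤ : ℕ∞) g' (Set.Ici 0) ∧ Set.EqOn g' f (Set.Icc 1 lam) ∧
          IsSolution lam δ g') → Set.EqOn g' g (Set.Ici 0) := by
  have hl0 : 0 < lam := by linarith
  have hc : lam / δ ≠ 0 := div_ne_zero hl0.ne' hδ
  have hD := zext_hasDerivAt hlam hf h1 h2
  have hF : Continuous (zext lam f 0) :=
    continuous_iff_continuousAt.2 fun x => (hD 0 x).continuousAt
  obtain ⟨p, hp, hp1⟩ := forward hlam hc (zext lam f) hD (fun n x hx => zext_left h1 n hx)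
  obtain ⟨u, huc, hu, hu1⟩ := backward (c := lam / δ) hlam hF (fun x hx => zext_right h2 0 hx)
  have hgc : ContinuousOn (fun x => p x + u x) (Ici 0) :=
    ContinuousOn.add (fun x _ => (hp x).continuousAt.continuousWithinAt) huc
  have hgd : ∀ x, 0 < x → HasDerivAt (fun x => p x + u x)
      (lam / δ * (p (lam * x) + u (lam * x))) x := by
    intro x hx
    refine ((hp x).add (hu x hx)).congr_deriv ?_
    ring
  have hgw : ∀ x, 0 ≤ x → HasDerivWithinAt (fun x => p x + u x)
      (lam / δ * (p (lam * x) + u (lam * x))) (Ici 0) x := by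
    intro x hx
    rcases hx.eq_or_lt with rfl | hx
    · refine hasDerivWithinAt_Ici_of_tendsto_deriv (s := Ioi 0)
        (fun y hy => (hgd y hy).differentiableAt.differentiableWithinAt)
        ((hgc 0 self_mem_Ici).mono Ioi_subset_Ici_self) self_mem_nhdsWithin ?_
      have h3 : ContinuousOn (fun x => lam / δ * (p (lam * x) + u (lam * x))) (Ici 0) :=
        continuousOn_const.mul
          (hgc.comp (f := fun x => lam * x) (by fun_prop) fun t ht => mul_nonneg hl0.le ht)
      have h4 := ((h3 0 self_mem_Ici).mono Ioi_subset_Ici_self).tendsto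
      refine h4.congr' ?_
      filter_upwards [self_mem_nhdsWithin] with y hy
      exact (hgd y hy).deriv.symm
    · exact (hgd x hx).hasDerivWithinAt
  have hgf : EqOn (fun x => p x + u x) f (Icc 1 lam) := by
    intro x hx
    simp only
    rw [hp1 x hx.2, hu1 x hx.1, add_zero, zext, indicator_of_mem hx, iteratedDerivWithin_zero]
  refine ⟨fun x => p x + u x, ⟨smooth_of_eq hl0 hgw, hgf, solution_of_eq hl0 hδ hgw⟩, ?_⟩
  rintro g' ⟨-, hg'f, hs⟩ x hx
  have := uniq_zero hlam hc (h := fun x => g' x - (p x + u x)) (hs.1.sub hgc)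
    (fun x hx => by
      refine ((sol_hasDerivAt hlam hδ hs hx).sub (hgd x hx)).congr_deriv ?_
      ring)
    (fun x hx => by
      rw [hg'f hx, ← hgf hx, sub_self]) x hx
  exact sub_eq_zero.1 this
end

section
/- Let λ > 1 and δ ≠ 0 be real numbers, and let f : [0,∞) → ℝ be a continuous solution of the integral equation (E_{λ,δ}). If f is periodic, i.e. there exists T > 0 such that f(x+T) = f(x) for all x ≥ 0, then f is identically zero. -/
open MeasureTheory

/-- Reduction modulo the period. -/
lemma per_nat (f : ℝ → ℝ) (T : ℝ) (hT : 0 < T)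
    (hper : ∀ x : ℝ, 0 ≤ x → f (x + T) = f x) (n : ℕ) (x : ℝ) (hx : 0 ≤ x) :
    f (x + n * T) = f x := by
  induction n with
  | zero => simp
  | succ k ih =>
    have h : x + ((k + 1 : ℕ) : ℝ) * T = (x + k * T) + T := by push_cast; ring
    rw [h, hper _ (by positivity), ih]

lemma per_reduce (f : ℝ → ℝ) (T : ℝ) (hT : 0 < T)
    (hper : ∀ x : ℝ, 0 ≤ x → f (x + T) = f x) (x : ℝ) (hx : 0 ≤ x) :
    ∃ y, 0 ≤ y ∧ y < T ∧ f x = f y := by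
  have h1 : (⌊x / T⌋₊ : ℝ) ≤ x / T := Nat.floor_le (by positivity)
  have h2 : x / T < ⌊x / T⌋₊ + 1 := Nat.lt_floor_add_one _
  rw [le_div_iff₀ hT] at h1
  rw [div_lt_iff₀ hT] at h2
  refine ⟨x - ⌊x / T⌋₊ * T, by linarith, by linarith, ?_⟩
  rw [← per_nat f T hT hper ⌊x / T⌋₊ (x - ⌊x / T⌋₊ * T) (by linarith)]
  congr 1
  ring

lemma per_integral (f : ℝ → ℝ) (T : ℝ) (hT : 0 < T)
    (hper : ∀ x : ℝ, 0 ≤ x → f (x + T) = f x) (a : ℝ) (ha : 0 ≤ a) :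
    ∫ t in a..(a + T), f t = ∫ t in (0:ℝ)..T, f t := by
  have hp : Function.Periodic (fun x => f (T * Int.fract (x / T))) T := by
    intro x
    have : (x + T) / T = x / T + 1 := by field_simp
    simp only [this, Int.fract_add_one]
  have heq : ∀ x, 0 ≤ x → f (T * Int.fract (x / T)) = f x := by
    intro x hx
    have h1 : (⌊x / T⌋₊ : ℝ) ≤ x / T := Nat.floor_le (by positivity)
    have h3 : (⌊x / T⌋ : ℝ) = (⌊x / T⌋₊ : ℝ) :=
      (natCast_floor_eq_intCast_floor (by positivity)).symm
    rw [le_div_iff₀ hT] at h1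
    have h4 : T * Int.fract (x / T) = x - ⌊x / T⌋₊ * T := by
      rw [Int.fract, h3]; field_simp
    rw [h4, ← per_nat f T hT hper ⌊x / T⌋₊ (x - ⌊x / T⌋₊ * T) (by linarith)]
    congr 1
    ring
  have h := hp.intervalIntegral_add_eq a 0
  rw [zero_add] at h
  rw [intervalIntegral.integral_congr (g := fun x => f (T * Int.fract (x / T))), h]
  · apply intervalIntegral.integral_congr
    intro x hx
    rw [Set.uIcc_of_le hT.le] at hx
    exact heq x hx.1
  · intro x hx
    rw [Set.uIcc_of_le (by linarith)] at hx
    exact (heq x (ha.trans hx.1)).symm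

/-- A period `T` yields a period `T / lam`. -/
lemma per_div (lam δ : ℝ) (hlam : 1 < lam) (hδ : δ ≠ 0)
    (f : ℝ → ℝ) (hsol : IsSolution lam δ f)
    (T : ℝ) (hT : 0 < T) (hper : ∀ x : ℝ, 0 ≤ x → f (x + T) = f x) :
    ∀ x : ℝ, 0 ≤ x → f (x + T / lam) = f x := by
  obtain ⟨hc, hE⟩ := hsol
  have hl : 0 < lam := by linarith
  have hint : ∀ a b, 0 ≤ a → 0 ≤ b → IntervalIntegrable f volume a b := by
    intro a b ha hb
    apply ContinuousOn.intervalIntegrable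
    apply hc.mono
    intro x hx
    exact (le_min ha hb).trans hx.1
  set I := ∫ t in (0:ℝ)..T, f t with hI
  have step : ∀ x, 0 ≤ x → f (x + T / lam) = f x + I / δ := by
    intro x hx
    have h1 := hE x hx
    have h2 := hE (x + T / lam) (by positivity)
    have h3 : lam * (x + T / lam) = lam * x + T := by field_simp
    have h0 : 0 ≤ lam * x := by positivity
    rw [h3, ← intervalIntegral.integral_add_adjacent_intervals
      (hint 0 (lam * x) le_rfl h0) (hint (lam * x) (lam * x + T) h0 (by positivity)),
      per_integral f T hT hper _ h0, h1, ← hI] at h2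
    have h4 : I = δ * (f (x + T / lam) - f x) := by linarith
    rw [h4, mul_div_cancel_left₀ _ hδ]
    ring
  have stepn : ∀ n : ℕ, f (0 + n * (T / lam)) = f 0 + n * (I / δ) := by
    intro n
    induction n with
    | zero => simp
    | succ k ih =>
      have h : (0:ℝ) + ((k + 1 : ℕ) : ℝ) * (T / lam) = (0 + k * (T / lam)) + T / lam := by
        push_cast; ring
      rw [h, step _ (by positivity), ih]
      push_cast; ring
  obtain ⟨C, hC⟩ := (isCompact_Icc (a := (0:ℝ)) (b := T)).exists_bound_of_continuousOn
    (hc.mono (fun x hx => hx.1))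
  have hb : ∀ x, 0 ≤ x → |f x| ≤ C := by
    intro x hx
    obtain ⟨y, hy0, hyT, hxy⟩ := per_reduce f T hT hper x hx
    rw [hxy]
    exact hC y ⟨hy0, hyT.le⟩
  have hz : I / δ = 0 := by
    by_contra hne
    have hpos : 0 < |I / δ| := abs_pos.mpr hne
    obtain ⟨n, hn⟩ := exists_nat_gt (2 * C / |I / δ|)
    rw [div_lt_iff₀ hpos] at hn
    have h1 := hb (0 + n * (T / lam)) (by positivity)
    have h2 := hb 0 le_rfl
    have h3 : (n:ℝ) * (I / δ) = f (0 + n * (T / lam)) - f 0 := by rw [stepn n]; ring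
    have h4 : (n:ℝ) * |I / δ| = |f (0 + n * (T / lam)) - f 0| := by
      rw [← h3, abs_mul, Nat.abs_cast]
    have h5 := abs_sub (f (0 + n * (T / lam))) (f 0)
    linarith
  intro x hx
  rw [step x hx, hz, add_zero]

/-- **Theorem 2, first part.** A periodic solution of `(E_{λ,δ})` with `λ > 1` and
`δ ≠ 0` is identically zero. -/
theorem periodic_solution_is_zero (lam δ : ℝ) (hlam : 1 < lam) (hδ : δ ≠ 0)
    (f : ℝ → ℝ) (hsol : IsSolution lam δ f)
    (T : ℝ) (hT : 0 < T) (hper : ∀ x : ℝ, 0 ≤ x → f (x + T) = f x) :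
    ∀ x : ℝ, 0 ≤ x → f x = 0 := by
  have hl : 0 < lam := by linarith
  have hn : ∀ n : ℕ, ∀ x : ℝ, 0 ≤ x → f (x + T / lam ^ n) = f x := by
    intro n
    induction n with
    | zero => simpa using hper
    | succ k ih =>
      have := per_div lam δ hlam hδ f hsol (T / lam ^ k) (by positivity) ih
      rwa [div_div, ← pow_succ] at this
  have hconst : ∀ x : ℝ, 0 ≤ x → f x = f 0 := by
    intro x hx
    choose y hy0 hyT hxy using fun n : ℕ =>
      per_reduce f (T / lam ^ n) (by positivity) (hn n) x hx
    have hlim : Filter.Tendsto (fun n : ℕ => T / lam ^ n) Filter.atTop (nhds 0) :=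
      Filter.Tendsto.div_atTop tendsto_const_nhds (tendsto_pow_atTop_atTop_of_one_lt hlam)
    have hy : Filter.Tendsto y Filter.atTop (nhds 0) :=
      squeeze_zero hy0 (fun n => (hyT n).le) hlim
    have hy2 : Filter.Tendsto y Filter.atTop (nhdsWithin 0 (Set.Ici 0)) :=
      tendsto_nhdsWithin_iff.mpr ⟨hy, Filter.Eventually.of_forall hy0⟩
    have h := (hsol.1 0 Set.self_mem_Ici).tendsto.comp hy2
    have h2 : f ∘ y = fun _ => f x := by
      funext n; exact (hxy n).symm
    rw [h2] at h
    exact tendsto_nhds_unique tendsto_const_nhds h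
  have h0 : f 0 = 0 := by
    have h := hsol.2 1 zero_le_one
    rw [hconst 1 zero_le_one, intervalIntegral.integral_congr (g := fun _ => f 0)] at h
    · simp at h
      rcases h with h | h
      · linarith
      · exact h
    · intro t ht
      rw [Set.uIcc_of_le (by linarith)] at ht
      exact hconst t ht.1
  intro x hx
  rw [hconst x hx, h0]
end

section
/- Let (uₙ)_{n∈ℕ} be a sequence of real numbers and θ ∈ [0,1) such that |u_{n+1} − uₙ| ≤ θⁿ · max_{0 ≤ k ≤ n} |u_k| for every n ∈ ℕ. Then the sequence (uₙ) converges. -/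
open Filter

/-- **Lemma 2.** If `|u_{n+1} − uₙ| ≤ θⁿ · max_{0 ≤ k ≤ n} |u_k|` with `0 ≤ θ < 1`,
then the sequence `(uₙ)` converges. -/
theorem converges_of_small_increments (u : ℕ → ℝ) (θ : ℝ) (hθ0 : 0 ≤ θ) (hθ1 : θ < 1)
    (h : ∀ n : ℕ, |u (n + 1) - u n| ≤
      θ ^ n * (Finset.range (n + 1)).sup' (Finset.nonempty_range_iff.mpr (Nat.succ_ne_zero n))
        (fun k => |u k|)) :
    ∃ L : ℝ, Tendsto u atTop (nhds L) := by
  have key : ∀ n : ℕ, ∀ k ≤ n, |u k| ≤ |u 0| * Real.exp (∑ i ∈ Finset.range n, θ ^ i) := by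
    intro n
    induction n with
    | zero =>
      intro k hk
      obtain rfl : k = 0 := by omega
      simp
    | succ n ih =>
      intro k hk
      rw [Finset.sum_range_succ, Real.exp_add, ← mul_assoc]
      set B := |u 0| * Real.exp (∑ i ∈ Finset.range n, θ ^ i) with hB
      have hB0 : 0 ≤ B := by positivity
      have hp : 0 ≤ θ ^ n := by positivity
      have he : θ ^ n + 1 ≤ Real.exp (θ ^ n) := Real.add_one_le_exp _
      have hm : B * (θ ^ n + 1) ≤ B * Real.exp (θ ^ n) := mul_le_mul_of_nonneg_left he hB0
      have hBp : 0 ≤ B * θ ^ n := mul_nonneg hB0 hp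
      rcases Nat.lt_or_ge n k with hlt | hle
      · obtain rfl : k = n + 1 := by omega
        have h1 := h n
        have h2 : (Finset.range (n + 1)).sup'
            (Finset.nonempty_range_iff.mpr (Nat.succ_ne_zero n)) (fun k => |u k|) ≤ B := by
          apply Finset.sup'_le
          intro j hj
          exact ih j (by simpa [Nat.lt_succ_iff] using hj)
        have h3 := mul_le_mul_of_nonneg_left h2 hp
        have h4 := ih n le_rfl
        have h5 := abs_sub_abs_le_abs_sub (u (n + 1)) (u n)
        linarith
      · have := ih k hle
        linarith
  have hbd : ∀ n : ℕ, ∀ k ≤ n, |u k| ≤ |u 0| * Real.exp (1 - θ)⁻¹ := by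
    intro n k hk
    refine (key n k hk).trans ?_
    gcongr
    rw [← tsum_geometric_of_lt_one hθ0 hθ1]
    exact (summable_geometric_of_lt_one hθ0 hθ1).sum_le_tsum _ (fun i _ => by positivity)
  refine cauchySeq_tendsto_of_complete
    (cauchySeq_of_le_geometric θ (|u 0| * Real.exp (1 - θ)⁻¹) hθ1 ?_)
  intro n
  rw [dist_comm, Real.dist_eq, mul_comm]
  refine (h n).trans (mul_le_mul_of_nonneg_left ?_ (by positivity))
  apply Finset.sup'_le
  intro j _
  exact hbd j j le_rfl
end

section
/- In the group G: (i) the map ((z,s), ξ) ↦ (z,s)^ξ from G × ℂ to G is continuous; (ii) for every (z,s) ∈ G and all ξ, ζ ∈ ℂ one has (z,s)^{ξ+ζ} = (z,s)^ξ · (z,s)^ζ; (iii) if (z,s) ∈ G with z ≠ 0, then an element of G commutes with (z,s) if and only if it is of the form (z,s)^ξ for some ξ ∈ ℂ. -/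
noncomputable section

/-- The group `G = ℂ ⋉ V` where `V = ℂ^{ℕ*}` (sequences indexed from `1`; here the
coordinate of index `n : ℕ` represents `s_{n+1}`). -/
abbrev G : Type := ℂ × (ℕ → ℂ)

/-- Generalized binomial coefficient `C(x, k) = x(x−1)⋯(x−k+1)/k!`. -/
def genBinom {K : Type*} [Field K] (x : K) (k : ℕ) : K :=
  (∏ i ∈ Finset.range k, (x - (i : K))) / (k.factorial : K)

/-- The operator `A^ξ = Σ_{i≥0} C(ξ,i) Xⁱ` on `V`, where `X` is the shift. -/
def Apow (ξ : ℂ) (s : ℕ → ℂ) : ℕ → ℂ :=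
  fun n => ∑ i ∈ Finset.range (n + 1), genBinom ξ i * s (n - i)

/-- Multiplication in `G`: `(ξ,s)·(ζ,t) = (ξ+ζ, A^ζ s + t)`. -/
def Gmul (g h : G) : G := (g.1 + h.1, Apow h.1 g.2 + h.2)

/-- The operator `B(ξ) = Σ_{n≥0} C(ξ,n+1) Xⁿ = (A^ξ − 1)/X` on `V`. -/
def Bop (ξ : ℂ) (s : ℕ → ℂ) : ℕ → ℂ :=
  fun n => ∑ i ∈ Finset.range (n + 1), genBinom ξ (i + 1) * s (n - i)

/-- The inverse operator `B(z)⁻¹` (for `z ≠ 0`), defined by solving the triangular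
system `B(z) (Binv z s) = s` recursively. -/
def Binv (z : ℂ) (s : ℕ → ℂ) : ℕ → ℂ :=
  fun n => Nat.strongRecOn n fun m ih =>
    (s m - ∑ i : Fin m, genBinom z (m - (i : ℕ) + 1) * ih i.1 i.2) / z

open Classical in
/-- The power `(z,s)^ξ`: `(zξ, B(zξ) B(z)⁻¹ s)` if `z ≠ 0`, and `(0, ξ s)` if `z = 0`. -/
def Gpow (g : G) (ξ : ℂ) : G :=
  if g.1 = 0 then (0, ξ • g.2) else (g.1 * ξ, Bop (g.1 * ξ) (Binv g.1 g.2))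

namespace PowAux
open PowerSeries

lemma genBinom_choose (x : ℂ) (n : ℕ) : genBinom x n = Ring.choose x n := by
  rw [Ring.choose_eq_smul, genBinom, div_eq_inv_mul, smul_eq_mul]
  congr 1
  induction n with
  | zero => simp
  | succ n ih =>
    rw [Finset.prod_range_succ, ih, descPochhammer_succ_right, Polynomial.smeval_mul]
    congr 1
    rw [Polynomial.smeval_sub, Polynomial.smeval_X, ← Polynomial.C_eq_natCast,
      Polynomial.smeval_C]
    simp

def a (x : ℂ) : PowerSeries ℂ := PowerSeries.mk (genBinom x)
def b (x : ℂ) : PowerSeries ℂ := PowerSeries.mk (fun n => genBinom x (n + 1))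
def d (x : ℂ) : PowerSeries ℂ :=
  PowerSeries.mk (fun n => (∏ i ∈ Finset.range n, (x - ((i + 1 : ℕ) : ℂ))) / ((n + 1).factorial : ℂ))

lemma a_eq (x : ℂ) : a x = PowerSeries.binomialSeries ℂ x := by
  ext n
  simp [a, genBinom_choose]

lemma a_add (x y : ℂ) : a (x + y) = a x * a y := by
  simp only [a_eq, binomialSeries_add]

lemma a_zero : a 0 = 1 := by
  simp only [a_eq, binomialSeries_zero]

lemma X_b (x : ℂ) : a x = X * b x + 1 := by
  ext n
  cases n with
  | zero => simp [a, genBinom]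
  | succ n => simp [a, b, coeff_succ_X_mul, coeff_one]

lemma b_eq (x : ℂ) : b x = C x * d x := by
  ext n
  simp only [b, d, coeff_mk, coeff_C_mul, genBinom]
  rw [Finset.prod_range_succ']
  simp
  ring

lemma d_const (x : ℂ) : constantCoeff (d x) = ((1 : ℂˣ) : ℂ) := by
  rw [← coeff_zero_eq_constantCoeff_apply]
  simp [d]

def dinv (x : ℂ) : PowerSeries ℂ := invOfUnit (d x) 1

lemma d_dinv (x : ℂ) : d x * dinv x = 1 := mul_invOfUnit _ _ (d_const x)

lemma mk_conv (f s : ℕ → ℂ) :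
    PowerSeries.mk (fun n => ∑ i ∈ Finset.range (n + 1), f i * s (n - i))
      = PowerSeries.mk f * PowerSeries.mk s := by
  ext n
  rw [coeff_mul, coeff_mk, Finset.Nat.sum_antidiagonal_eq_sum_range_succ_mk]
  simp

lemma mk_Apow (x : ℂ) (s : ℕ → ℂ) : PowerSeries.mk (Apow x s) = a x * PowerSeries.mk s :=
  mk_conv _ _

lemma mk_Bop (x : ℂ) (s : ℕ → ℂ) : PowerSeries.mk (Bop x s) = b x * PowerSeries.mk s :=
  mk_conv _ _

lemma mk_inj {s t : ℕ → ℂ} : PowerSeries.mk s = PowerSeries.mk t ↔ s = t := by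
  constructor
  · intro h
    funext n
    simpa using congrArg (coeff n) h
  · rintro rfl; rfl

lemma mk_add (s t : ℕ → ℂ) :
    PowerSeries.mk (s + t) = PowerSeries.mk s + PowerSeries.mk t := by
  ext n; simp

lemma Binv_rec (z : ℂ) (s : ℕ → ℂ) (n : ℕ) :
    Binv z s n = (s n - ∑ i ∈ Finset.range n, genBinom z (n - i + 1) * Binv z s i) / z := by
  rw [Finset.sum_range]
  unfold Binv
  conv_lhs => rw [Nat.strongRecOn_eq]

lemma Bop_Binv (z : ℂ) (hz : z ≠ 0) (s : ℕ → ℂ) : Bop z (Binv z s) = s := by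
  funext n
  unfold Bop
  rw [← Finset.sum_range_reflect, Finset.sum_range_succ]
  have h1 : ∀ i ∈ Finset.range n, genBinom z (n + 1 - 1 - i + 1) * Binv z s (n - (n + 1 - 1 - i))
      = genBinom z (n - i + 1) * Binv z s i := by
    intro i hi
    have := Finset.mem_range.1 hi
    congr 2
    omega
  rw [Finset.sum_congr rfl h1]
  have h2 : n + 1 - 1 - n = 0 := by omega
  rw [h2, Nat.sub_zero, Binv_rec z s n]
  simp [genBinom]
  field_simp
  ring

lemma b_Binv (z : ℂ) (hz : z ≠ 0) (s : ℕ → ℂ) :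
    b z * PowerSeries.mk (Binv z s) = PowerSeries.mk s := by
  rw [← mk_Bop, Bop_Binv z hz]

lemma C_ne {z : ℂ} (hz : z ≠ 0) : (C z : PowerSeries ℂ) ≠ 0 := by
  intro h
  apply hz
  simpa using congrArg (coeff 0) h

lemma b_ne {z : ℂ} (hz : z ≠ 0) : b z ≠ 0 := by
  rw [b_eq]
  refine mul_ne_zero (C_ne hz) ?_
  intro h
  have := d_dinv z
  rw [h, zero_mul] at this
  exact zero_ne_one this

lemma Gpow_fst (g : G) (ξ : ℂ) : (Gpow g ξ).1 = g.1 * ξ := by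
  unfold Gpow
  split_ifs with h <;> simp [h]

lemma Gpow_snd (g : G) (ξ : ℂ) : PowerSeries.mk (Gpow g ξ).2
    = C ξ * (d (g.1 * ξ) * (dinv g.1 * PowerSeries.mk g.2)) := by
  unfold Gpow
  split_ifs with h
  · rw [h, zero_mul, ← mul_assoc (d 0), d_dinv, one_mul]
    ext n; simp
  · rw [mk_Bop]
    conv_rhs => rw [← b_Binv g.1 h g.2]
    rw [b_eq, b_eq, map_mul]
    linear_combination (-C g.1 * C ξ * d (g.1 * ξ) * PowerSeries.mk (Binv g.1 g.2)) * d_dinv g.1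

def CC {T : Type*} [TopologicalSpace T] (f : T → PowerSeries ℂ) : Prop :=
  ∀ n, Continuous fun t => coeff n (f t)

lemma CC.mul {T : Type*} [TopologicalSpace T] {f g : T → PowerSeries ℂ} (hf : CC f) (hg : CC g) :
    CC fun t => f t * g t := by
  intro n
  simp only [coeff_mul]
  exact continuous_finsetSum _ fun i _ => (hf _).mul (hg _)

lemma CC_d : CC d := by
  intro n
  simp only [d, coeff_mk]
  fun_prop

lemma CC_dinv : CC dinv := by
  intro n
  induction n using Nat.strong_induction_on with
  | _ n ih =>
    have e : (fun t => coeff n (dinv t)) = _ := funext fun t => coeff_invOfUnit n (d t) 1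
    rw [e]
    split_ifs with h
    · exact continuous_const
    · refine continuous_const.mul (continuous_finsetSum _ fun i _ => ?_)
      split_ifs with h2
      · exact (CC_d _).mul (ih _ h2)
      · exact continuous_const

lemma CC_C : CC (fun x : ℂ => C x) := by
  intro n
  simp only [coeff_C]
  split_ifs <;> fun_prop

lemma CC.comp {T S : Type*} [TopologicalSpace T] [TopologicalSpace S] {f : T → PowerSeries ℂ}
    (hf : CC f) {g : S → T} (hg : Continuous g) : CC fun x => f (g x) :=
  fun n => (hf n).comp hg

lemma continuous_Gpow : Continuous (fun p : G × ℂ => Gpow p.1 p.2) := by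
  refine Continuous.prodMk (f := fun p : G × ℂ => (Gpow p.1 p.2).1)
    (g := fun p : G × ℂ => (Gpow p.1 p.2).2) ?_ ?_
  · simp only [Gpow_fst]
    fun_prop
  · refine continuous_pi fun n => ?_
    have h : CC fun p : G × ℂ => PowerSeries.mk (Gpow p.1 p.2).2 := by
      simp only [Gpow_snd]
      refine (CC_C.comp (by fun_prop)).mul ((CC_d.comp (by fun_prop)).mul
        ((CC_dinv.comp (by fun_prop)).mul ?_))
      intro n
      simp only [coeff_mk]
      fun_prop
    simpa using h n

lemma b_add (x y : ℂ) : b (x + y) = a y * b x + b y := by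
  apply mul_left_cancel₀ (X_ne_zero (R := ℂ))
  have h := a_add x y
  rw [X_b (x + y)] at h
  linear_combination h + (a y) * X_b x + X_b y

lemma Gpow_add (g : G) (ξ ζ : ℂ) : Gpow g (ξ + ζ) = Gmul (Gpow g ξ) (Gpow g ζ) := by
  by_cases h : g.1 = 0
  · unfold Gmul
    refine Prod.ext ?_ ?_
    · simp only [Gpow_fst]; ring
    · rw [← mk_inj]
      simp only [mk_add, mk_Apow, Gpow_fst, Gpow_snd, h, zero_mul, a_zero, map_add]
      ring
  · unfold Gmul
    refine Prod.ext ?_ ?_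
    · simp only [Gpow_fst]; ring
    · rw [← mk_inj]
      simp only [mk_add, mk_Apow]
      simp only [Gpow, if_neg h, mk_Bop, mul_add, b_add]
      ring

lemma comm_iff (g h : G) : Gmul g h = Gmul h g ↔
    b h.1 * PowerSeries.mk g.2 = b g.1 * PowerSeries.mk h.2 := by
  unfold Gmul
  rw [Prod.ext_iff, ← mk_inj]
  simp only [mk_add, mk_Apow, add_comm h.1 g.1, true_and, X_b]
  rw [← mul_right_inj' (X_ne_zero (R := ℂ)) (b := b h.1 * PowerSeries.mk g.2)]
  constructor <;> intro h <;> linear_combination h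

lemma centralizer (g : G) (hg : g.1 ≠ 0) (h : G) :
    Gmul g h = Gmul h g ↔ ∃ ξ : ℂ, h = Gpow g ξ := by
  rw [comm_iff]
  have hb := b_Binv g.1 hg g.2
  constructor
  · intro e
    refine ⟨h.1 / g.1, ?_⟩
    have e1 : g.1 * (h.1 / g.1) = h.1 := by field_simp
    refine Prod.ext ?_ ?_
    · rw [Gpow_fst, e1]
    · rw [← mk_inj]
      simp only [Gpow, if_neg hg, e1, mk_Bop]
      apply mul_left_cancel₀ (b_ne hg)
      linear_combination -e - b h.1 * hb
  · rintro ⟨ξ, rfl⟩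
    simp only [Gpow, if_neg hg, mk_Bop]
    linear_combination -b (g.1 * ξ) * hb

end PowAux

/-- **Lemma 4 (powers in `G`).** The power map is continuous, is a one-parameter
group in the exponent, and for `z ≠ 0` the centralizer of `(z,s)` is exactly the set
of its powers. -/
theorem power_properties :
    Continuous (fun p : G × ℂ => Gpow p.1 p.2) ∧
    (∀ (g : G) (ξ ζ : ℂ), Gpow g (ξ + ζ) = Gmul (Gpow g ξ) (Gpow g ζ)) ∧
    (∀ g : G, g.1 ≠ 0 → ∀ h : G, (Gmul g h = Gmul h g ↔ ∃ ξ : ℂ, h = Gpow g ξ)) := by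
  exact ⟨PowAux.continuous_Gpow, PowAux.Gpow_add, PowAux.centralizer⟩

end
end

section
/- For all complex numbers λ and x and every integer n ≥ 0, one has C(λx, n) = Σ_{i=0}^{n} q_{i,n}(λ) · C(x, i), where C(·,·) denotes the generalized binomial coefficient. -/
noncomputable section

/-- The polynomial `q_{i,n}(λ) = Σ_{n₁+⋯+nᵢ=n, nⱼ≥1} C(λ,n₁)⋯C(λ,nᵢ)`. -/
def qpoly {K : Type*} [Field K] (i n : ℕ) (lam : K) : K :=
  ∑ f ∈ (Finset.Nat.antidiagonalTuple i n).filter (fun f => ∀ j, 1 ≤ f j),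
    ∏ j, genBinom lam (f j)

open PowerSeries in
theorem aux_coeff_pow {K : Type*} [Field K] (F : PowerSeries K) (i n : ℕ) :
    coeff n (F ^ i) = ∑ f ∈ Finset.Nat.antidiagonalTuple i n, ∏ j, coeff (f j) F := by
  induction i generalizing n with
  | zero =>
    cases n <;> simp [PowerSeries.coeff_one]
  | succ i ih =>
    rw [pow_succ', coeff_mul]
    simp_rw [ih, Finset.mul_sum]
    rw [Finset.sum_sigma']
    refine Finset.sum_bij' (fun p _ => (Fin.cons p.1.1 p.2 : Fin (i+1) → ℕ))
      (fun f _ => ⟨(f 0, ∑ j, Fin.tail f j), Fin.tail f⟩) ?_ ?_ ?_ ?_ ?_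
    · rintro ⟨⟨a, b⟩, f⟩ h
      simp only [Finset.mem_sigma, Finset.HasAntidiagonal.mem_antidiagonal,
        Finset.Nat.mem_antidiagonalTuple] at h ⊢
      simp [Fin.sum_univ_succ, h]
    · intro f h
      simp only [Finset.mem_sigma, Finset.HasAntidiagonal.mem_antidiagonal,
        Finset.Nat.mem_antidiagonalTuple, Fin.sum_univ_succ] at h ⊢
      simpa [Fin.tail] using h
    · rintro ⟨⟨a, b⟩, f⟩ h
      simp only [Finset.mem_sigma, Finset.HasAntidiagonal.mem_antidiagonal,
        Finset.Nat.mem_antidiagonalTuple] at h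
      obtain ⟨h1, rfl⟩ := h
      simp
    · intro f h
      simp
    · rintro ⟨⟨a, b⟩, f⟩ h
      simp [Fin.prod_univ_succ]

theorem aux_genBinom (x : ℂ) (k : ℕ) : genBinom x k = Ring.choose x k := by
  have h : (descPochhammer ℤ k).smeval x = ∏ i ∈ Finset.range k, (x - (i : ℂ)) := by
    induction k with
    | zero => simp
    | succ k ih =>
      rw [descPochhammer_succ_right, Polynomial.smeval_mul, ih, Finset.prod_range_succ]
      simp [Polynomial.smeval_sub, Polynomial.smeval_natCast]
  rw [Ring.choose_eq_smul, genBinom, h]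
  simp [div_eq_inv_mul]

open PowerSeries in
theorem aux_qpoly (i n : ℕ) (lam : ℂ) :
    qpoly i n lam = coeff n ((PowerSeries.binomialSeries ℂ lam - 1) ^ i) := by
  rw [aux_coeff_pow, qpoly, Finset.sum_filter]
  refine Finset.sum_congr rfl fun f _ => ?_
  split_ifs with h
  · refine Finset.prod_congr rfl fun j _ => ?_
    have : f j ≠ 0 := by have := h j; omega
    simp [aux_genBinom, PowerSeries.coeff_one, this]
  · push Not at h
    obtain ⟨j, hj⟩ := h
    symm
    apply Finset.prod_eq_zero (Finset.mem_univ j)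
    have : f j = 0 := by omega
    simp [this]

theorem aux_qpoly_zero {i n : ℕ} (h : n < i) (lam : ℂ) : qpoly i n lam = 0 := by
  rw [qpoly]
  refine Finset.sum_eq_zero fun f hf => ?_
  exfalso
  simp only [Finset.mem_filter, Finset.Nat.mem_antidiagonalTuple] at hf
  have : ∑ j : Fin i, 1 ≤ ∑ j, f j := Finset.sum_le_sum fun j _ => hf.2 j
  simp at this
  omega

open PowerSeries in
theorem aux_nat (lam : ℂ) (m n : ℕ) :
    genBinom (lam * m) n = ∑ i ∈ Finset.range (n + 1), qpoly i n lam * genBinom (m : ℂ) i := by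
  have h1 : ∀ m : ℕ, PowerSeries.binomialSeries ℂ (lam * m) = PowerSeries.binomialSeries ℂ lam ^ m := by
    intro m
    induction m with
    | zero => simp
    | succ m ih => rw [pow_succ, ← ih, ← PowerSeries.binomialSeries_add]; congr 1; push_cast; ring
  have h2 : genBinom (lam * m) n = coeff n (PowerSeries.binomialSeries ℂ (lam * m)) := by
    simp [aux_genBinom]
  have h3 : genBinom (lam * m) n = ∑ i ∈ Finset.range (m + 1), qpoly i n lam * (m.choose i : ℂ) := by
    rw [h2, h1]
    conv_lhs => rw [← sub_add_cancel (PowerSeries.binomialSeries ℂ lam) 1, add_pow]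
    rw [map_sum]
    refine Finset.sum_congr rfl fun i _ => ?_
    rw [aux_qpoly, one_pow, mul_one, mul_comm, ← nsmul_eq_mul, map_nsmul, nsmul_eq_mul, mul_comm]
  rw [h3]
  simp_rw [aux_genBinom, Ring.choose_natCast]
  rcases le_total m n with h | h
  · refine Finset.sum_subset (Finset.range_mono (by omega)) fun i _ hi => ?_
    rw [Nat.choose_eq_zero_of_lt (by simpa using hi)]; simp
  · symm
    refine Finset.sum_subset (Finset.range_mono (by omega)) fun i _ hi => ?_
    rw [aux_qpoly_zero (by simpa using hi)]; simp

/-- The generalized binomial coefficient as a polynomial. -/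
def auxPoly (n : ℕ) : Polynomial ℂ :=
  Polynomial.C ((n.factorial : ℂ)⁻¹) * ∏ i ∈ Finset.range n, (Polynomial.X - Polynomial.C (i : ℂ))

theorem auxPoly_eval (n : ℕ) (x : ℂ) : (auxPoly n).eval x = genBinom x n := by
  simp [auxPoly, genBinom, Polynomial.eval_prod, div_eq_inv_mul]

/-- **Proposition (binomials of products).**
`C(λx, n) = Σ_{i=0}^{n} q_{i,n}(λ) C(x, i)` for all complex `λ, x`. -/
theorem genBinom_mul (lam x : ℂ) (n : ℕ) :
    genBinom (lam * x) n = ∑ i ∈ Finset.range (n + 1), qpoly i n lam * genBinom x i := by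
  have key : (auxPoly n).comp (Polynomial.C lam * Polynomial.X) =
      ∑ i ∈ Finset.range (n + 1), Polynomial.C (qpoly i n lam) * auxPoly i := by
    apply Polynomial.eq_of_infinite_eval_eq
    refine (Set.infinite_range_of_injective (Nat.cast_injective (R := ℂ))).mono ?_
    rintro _ ⟨m, rfl⟩
    simp [Polynomial.eval_finsetSum, auxPoly_eval, aux_nat]
  have := congrArg (Polynomial.eval x) key
  simpa [Polynomial.eval_finsetSum, auxPoly_eval] using this

end
end

section
/- The polynomials q_{i,n} satisfy the following identities (as identities of polynomials in the variable λ): q_{1,n}(λ) = C(λ,n) for every n ≥ 1; q_{n,n}(λ) = λⁿ for every n ≥ 0; q_{n,n+1}(λ) = ((λ−1)/2)·n·λⁿ for every n ≥ 0; and for all integers n ≥ 2 and 2 ≤ i ≤ n, q_{i,n+1}(λ) = (λi/(n+1))·q_{i−1,n}(λ) + ((λi − n)/(n+1))·q_{i,n}(λ). -/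
noncomputable section

/-- The generating series of the `C(λ,k)`, `k ≥ 1`. -/
def genF (lam : ℂ) : PowerSeries ℂ :=
  PowerSeries.mk fun k => if k = 0 then 0 else genBinom lam k

theorem genBinom_succ (lam : ℂ) (k : ℕ) :
    genBinom lam (k + 1) * (k + 1) = genBinom lam k * (lam - k) := by
  unfold genBinom
  have h1 : (k.factorial : ℂ) ≠ 0 := by exact_mod_cast k.factorial_ne_zero
  have h2 : (k : ℂ) + 1 ≠ 0 := by exact_mod_cast k.succ_ne_zero
  rw [Finset.prod_range_succ, Nat.factorial_succ]
  push_cast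
  field_simp

theorem qpoly_eq_coeff (lam : ℂ) (i n : ℕ) :
    qpoly i n lam = PowerSeries.coeff n (genF lam ^ i) := by
  have h : genF lam ^ i = ∏ _j : Fin i, genF lam := by simp
  rw [h, PowerSeries.coeff_prod, qpoly, Finset.sum_filter]
  refine Finset.sum_bij' (fun f _ => Finsupp.equivFunOnFinite.symm f) (fun l _ => ⇑l)
    ?_ ?_ ?_ ?_ ?_
  · intro f hf
    simpa [Finset.mem_finsuppAntidiag, Finset.Nat.mem_antidiagonalTuple] using hf
  · intro l hl
    simpa [Finset.mem_finsuppAntidiag, Finset.Nat.mem_antidiagonalTuple] using hl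
  · intro f hf
    rfl
  · intro l hl
    ext j
    rfl
  · intro f hf
    split_ifs with hp
    · refine Finset.prod_congr rfl fun j _ => ?_
      have := hp j
      have h0 : f j ≠ 0 := by omega
      simp [genF, h0]
    · push Not at hp
      obtain ⟨j, hj⟩ := hp
      have h0 : f j = 0 := by omega
      symm
      apply Finset.prod_eq_zero (Finset.mem_univ j)
      simp [genF, h0]

theorem genF_deriv (lam : ℂ) :
    (1 + PowerSeries.X) * PowerSeries.derivative ℂ (genF lam)
      = PowerSeries.C lam * (1 + genF lam) := by
  ext n
  rw [add_mul, one_mul, map_add, PowerSeries.coeff_C_mul, map_add]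
  have hb := genBinom_succ lam n
  cases n with
  | zero =>
    have h0 : genBinom lam 0 = 1 := by simp [genBinom]
    rw [h0] at hb
    simp [PowerSeries.coeff_derivative, genF] at hb ⊢
    exact hb
  | succ n =>
    rw [PowerSeries.coeff_succ_X_mul]
    simp [PowerSeries.coeff_derivative, PowerSeries.coeff_one, genF] at hb ⊢
    linear_combination hb

theorem qpoly_rec (lam : ℂ) (i n : ℕ) :
    ((n : ℂ) + 1) * qpoly (i + 1) (n + 1) lam + n * qpoly (i + 1) n lam
      = (i + 1) * lam * (qpoly i n lam + qpoly (i + 1) n lam) := by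
  have key : (1 + PowerSeries.X) * PowerSeries.derivative ℂ (genF lam ^ (i + 1))
      = PowerSeries.C (((i : ℂ) + 1) * lam) * (genF lam ^ i + genF lam ^ (i + 1)) := by
    rw [Derivation.leibniz_pow]
    have := genF_deriv lam
    simp only [smul_eq_mul, nsmul_eq_mul, Nat.add_sub_cancel, map_mul, map_add, map_one,
      map_natCast, Nat.cast_add, Nat.cast_one]
    linear_combination ((i : PowerSeries ℂ) + 1) * genF lam ^ i * this
  have hc := congrArg (PowerSeries.coeff n) key
  rw [add_mul, one_mul, map_add, PowerSeries.coeff_C_mul, map_add] at hc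
  simp only [qpoly_eq_coeff]
  cases n with
  | zero =>
    rw [PowerSeries.coeff_derivative, PowerSeries.coeff_zero_X_mul] at hc
    push_cast at hc ⊢
    linear_combination hc
  | succ n =>
    rw [PowerSeries.coeff_succ_X_mul, PowerSeries.coeff_derivative,
      PowerSeries.coeff_derivative] at hc
    push_cast at hc ⊢
    linear_combination hc

theorem qpoly_lt (lam : ℂ) (i n : ℕ) (h : n < i) : qpoly i n lam = 0 := by
  rw [qpoly, Finset.filter_eq_empty_iff.2, Finset.sum_empty]
  intro f hf hp
  rw [Finset.Nat.mem_antidiagonalTuple] at hf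
  have : ∑ _j : Fin i, 1 ≤ ∑ j, f j := Finset.sum_le_sum fun j _ => hp j
  simp at this
  omega

theorem qpoly_diag (lam : ℂ) (n : ℕ) : qpoly n n lam = lam ^ n := by
  induction n with
  | zero => simp [qpoly_eq_coeff]
  | succ n ih =>
    have h := qpoly_rec lam n n
    rw [qpoly_lt lam (n + 1) n (by omega), ih] at h
    have h2 : (n : ℂ) + 1 ≠ 0 := by exact_mod_cast n.succ_ne_zero
    apply mul_left_cancel₀ h2
    linear_combination h

theorem qpoly_diag_succ (lam : ℂ) (n : ℕ) :
    qpoly n (n + 1) lam = ((lam - 1) / 2) * n * lam ^ n := by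
  induction n with
  | zero => simp [qpoly_eq_coeff, PowerSeries.coeff_one]
  | succ n ih =>
    have h := qpoly_rec lam n (n + 1)
    rw [qpoly_diag, ih] at h
    have h2 : (n : ℂ) + 1 + 1 ≠ 0 := by exact_mod_cast (n + 1).succ_ne_zero
    apply mul_left_cancel₀ h2
    push_cast at h ⊢
    linear_combination h

/-- **Lemma 8 (recurrence for the `q_{i,n}`).** The polynomial identities
`q_{1,n} = C(λ,n)`, `q_{n,n} = λⁿ`, `q_{n,n+1} = ((λ−1)/2)·n·λⁿ`, and for
`2 ≤ i ≤ n`, `q_{i,n+1} = (λi/(n+1)) q_{i−1,n} + ((λi−n)/(n+1)) q_{i,n}`. -/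
theorem qpoly_recurrence :
    (∀ (lam : ℂ) (n : ℕ), 1 ≤ n → qpoly 1 n lam = genBinom lam n) ∧
    (∀ (lam : ℂ) (n : ℕ), qpoly n n lam = lam ^ n) ∧
    (∀ (lam : ℂ) (n : ℕ), qpoly n (n + 1) lam = ((lam - 1) / 2) * n * lam ^ n) ∧
    (∀ (lam : ℂ) (n i : ℕ), 2 ≤ n → 2 ≤ i → i ≤ n →
      qpoly i (n + 1) lam =
        (lam * i / (n + 1)) * qpoly (i - 1) n lam +
          ((lam * i - n) / (n + 1)) * qpoly i n lam) := by
  refine ⟨?_, qpoly_diag, qpoly_diag_succ, ?_⟩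
  · intro lam n hn
    have h0 : n ≠ 0 := by omega
    simp [qpoly_eq_coeff, genF, h0]
  · intro lam n i _ hi _
    obtain ⟨i, rfl⟩ : ∃ k, i = k + 1 := ⟨i - 1, by omega⟩
    have h := qpoly_rec lam i n
    have h2 : (n : ℂ) + 1 ≠ 0 := by exact_mod_cast n.succ_ne_zero
    rw [Nat.add_sub_cancel]
    push_cast
    field_simp
    linear_combination h

end
end

section
/- Let λ > 1 be a real number and i ≥ 1 an integer. Then q_{n,n+i}(λ) is asymptotically equivalent, as n → ∞, to ((λ−1)ⁱ/(2ⁱ·i!))·nⁱ·λⁿ; that is, lim_{n→∞} q_{n,n+i}(λ)/(nⁱ·λⁿ) = (λ−1)ⁱ/(2ⁱ·i!). -/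
open Filter

noncomputable section

open PowerSeries in
theorem qpoly_coeff (lam : ℝ) (m N : ℕ) :
    qpoly m N lam =
      coeff N ((PowerSeries.mk fun k => if k = 0 then 0 else genBinom lam k) ^ m) := by
  have h := coeff_prod (R := ℝ) (ι := Fin m)
    (fun _ => PowerSeries.mk fun k => if k = 0 then 0 else genBinom lam k) N Finset.univ
  rw [Finset.prod_const, Finset.card_univ, Fintype.card_fin] at h
  rw [h, qpoly, Finset.sum_filter]
  symm
  refine Finset.sum_bij (fun l _ => (l : Fin m → ℕ)) ?_ ?_ ?_ ?_
  · intro l hl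
    rw [Finset.Nat.mem_antidiagonalTuple]
    exact (Finset.mem_finsuppAntidiag.1 hl).1
  · intro a _ b _ hab
    exact DFunLike.coe_injective hab
  · intro f hf
    refine ⟨Finsupp.equivFunOnFinite.symm f, ?_, rfl⟩
    rw [Finset.mem_finsuppAntidiag]
    exact ⟨Finset.Nat.mem_antidiagonalTuple.1 hf, Finset.subset_univ _⟩
  · intro l hl
    simp only [coeff_mk]
    split_ifs with hc
    · refine Finset.prod_congr rfl fun j _ => ?_
      rw [if_neg]
      have := hc j
      omega
    · push Not at hc
      obtain ⟨j, hj⟩ := hc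
      refine Finset.prod_eq_zero (Finset.mem_univ j) ?_
      rw [if_pos]
      omega

open PowerSeries in
theorem qpoly_expand (lam : ℝ) (hlam : lam ≠ 0) (n i : ℕ) :
    qpoly n (n + i) lam = lam ^ n * ∑ j ∈ Finset.range (i + 1), (n.choose j : ℝ) *
      coeff (i - j) ((PowerSeries.mk fun k => genBinom lam (k + 2) / lam) ^ j) := by
  set h : PowerSeries ℝ := PowerSeries.mk fun k => genBinom lam (k + 2) / lam with hh
  have hB : (PowerSeries.mk fun k => if k = 0 then 0 else genBinom lam k) =
      X * (C lam * (X * h + 1)) := by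
    ext k
    rcases k with _ | _ | k
    · simp
    · rw [coeff_succ_X_mul, coeff_C_mul]
      simp [genBinom]
    · rw [coeff_succ_X_mul, coeff_C_mul, map_add, coeff_succ_X_mul, hh]
      simp only [coeff_mk, coeff_one]
      simp
      field_simp
  rw [qpoly_coeff, hB, mul_pow, mul_pow, add_comm n i, coeff_X_pow_mul, ← map_pow, coeff_C_mul,
    add_pow, map_sum]
  congr 1
  have key : ∀ j, coeff i ((X * h) ^ j * 1 ^ (n - j) * ((n.choose j : ℕ) : PowerSeries ℝ)) =
      (n.choose j : ℝ) * (if j ≤ i then coeff (i - j) (h ^ j) else 0) := by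
    intro j
    rw [one_pow, mul_one, mul_comm, ← nsmul_eq_mul, map_nsmul, nsmul_eq_mul, mul_pow,
      coeff_X_pow_mul']
  simp_rw [key]
  trans ∑ j ∈ Finset.range (n + i + 1),
    (n.choose j : ℝ) * (if j ≤ i then coeff (i - j) (h ^ j) else 0)
  · refine Finset.sum_subset (fun j hj => ?_) fun j _ hj => ?_
    · simp only [Finset.mem_range] at *
      omega
    · simp only [Finset.mem_range] at hj
      rw [Nat.choose_eq_zero_of_lt (by omega)]
      simp
  · symm
    refine (Finset.sum_congr rfl fun j hj => ?_).trans
      (Finset.sum_subset (fun j hj => ?_) fun j _ hj => ?_)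
    · simp only [Finset.mem_range] at hj
      rw [if_pos (by omega)]
    · simp only [Finset.mem_range] at *
      omega
    · simp only [Finset.mem_range] at hj
      rw [if_neg (by omega), mul_zero]

theorem tendsto_choose_div (i j : ℕ) (hj : j ≤ i) :
    Tendsto (fun n : ℕ => (n.choose j : ℝ) / (n : ℝ) ^ i) atTop
      (nhds (if j = i then 1 / (i.factorial : ℝ) else 0)) := by
  have h1 : Tendsto (fun n : ℕ => (n : ℝ) * (1 / (n : ℝ))) atTop (nhds 1) := by
    refine tendsto_const_nhds.congr' ?_
    filter_upwards [eventually_gt_atTop 0] with n hn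
    have : (n : ℝ) ≠ 0 := by positivity
    field_simp
  have h2 := ProbabilityTheory.tendsto_choose_mul_pow_atTop j h1
  have h3 : Tendsto (fun n : ℕ => (1 / (n : ℝ)) ^ (i - j)) atTop (nhds (0 ^ (i - j))) :=
    tendsto_one_div_atTop_nhds_zero_nat.pow _
  have h4 := h2.mul h3
  refine (h4.congr fun n => ?_).trans (le_of_eq ?_)
  · rw [mul_assoc, ← pow_add, Nat.add_sub_cancel' hj, one_div, inv_pow, div_eq_mul_inv]
  · split_ifs with hc
    · subst hc
      simp
    · rw [zero_pow (by omega), mul_zero]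

/-- **Proposition (asymptotics of `q_{n,n+i}`).** For `λ > 1` and `i ≥ 1`,
`q_{n,n+i}(λ) ∼ ((λ−1)ⁱ/(2ⁱ i!)) nⁱ λⁿ` as `n → ∞`. -/
theorem qpoly_asymptotic (lam : ℝ) (hlam : 1 < lam) (i : ℕ) (hi : 1 ≤ i) :
    Tendsto (fun n : ℕ => qpoly n (n + i) lam / ((n : ℝ) ^ i * lam ^ n)) atTop
      (nhds ((lam - 1) ^ i / (2 ^ i * (i.factorial : ℝ)))) := by
  have hl : lam ≠ 0 := by linarith
  have hlim : Tendsto (fun n : ℕ => ∑ j ∈ Finset.range (i + 1), ((n.choose j : ℝ) / (n : ℝ) ^ i) *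
      PowerSeries.coeff (i - j) ((PowerSeries.mk fun k => genBinom lam (k + 2) / lam) ^ j)) atTop
      (nhds (∑ j ∈ Finset.range (i + 1), (if j = i then 1 / (i.factorial : ℝ) else 0) *
      PowerSeries.coeff (i - j) ((PowerSeries.mk fun k => genBinom lam (k + 2) / lam) ^ j))) := by
    refine tendsto_finsetSum _ fun j hj => ?_
    refine (tendsto_choose_div i j ?_).mul_const _
    simp only [Finset.mem_range] at hj
    omega
  refine (hlim.congr fun n => ?_).trans (le_of_eq ?_)
  · rw [qpoly_expand lam hl, mul_comm ((n : ℝ) ^ i), mul_div_mul_left _ _ (pow_ne_zero n hl),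
      Finset.sum_div]
    refine Finset.sum_congr rfl fun j _ => ?_
    ring
  · congr 1
    rw [Finset.sum_eq_single i]
    · rw [if_pos rfl, Nat.sub_self, PowerSeries.coeff_zero_eq_constantCoeff_apply, map_pow,
        ← PowerSeries.coeff_zero_eq_constantCoeff_apply, PowerSeries.coeff_mk]
      have : genBinom lam (0 + 2) / lam = (lam - 1) / 2 := by
        simp [genBinom, Finset.prod_range_succ]
        field_simp
      rw [this, div_pow]
      field_simp
    · intro j _ hj
      rw [if_neg hj, zero_mul]
    · intro h
      simp at h

end
end

section
/- Let λ ≥ 1 be an integer. Then for every integer n ≥ 1 and all integers i, j with 1 ≤ i ≤ j ≤ n, one has q_{i,j}(λ) ≤ (2λ−1)ⁿ. -/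
noncomputable section

theorem genBinom_nat (l k : ℕ) : genBinom (l : ℝ) k = (l.choose k : ℝ) := by
  have h : ∏ i ∈ Finset.range k, ((l : ℝ) - (i : ℝ)) = (l.descFactorial k : ℝ) := by
    induction k with
    | zero => simp
    | succ k ih =>
      rw [Finset.prod_range_succ, ih, Nat.descFactorial_succ]
      rcases le_or_gt k l with hk | hk
      · rw [Nat.cast_mul, Nat.cast_sub hk]; ring
      · rw [Nat.descFactorial_of_lt hk]; simp
  have hf : (k.factorial : ℝ) ≠ 0 := by positivity
  unfold genBinom
  rw [h, div_eq_iff hf, Nat.descFactorial_eq_factorial_mul_choose]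
  push_cast; ring

theorem partial_binom_le (l j : ℕ) (x : ℝ) (hx : 0 ≤ x) :
    ∑ k ∈ Finset.Icc 1 j, (l.choose k : ℝ) * x ^ k ≤ (1 + x) ^ l - 1 := by
  have h1 : (1 + x) ^ l = ∑ k ∈ Finset.range (l + 1), (l.choose k : ℝ) * x ^ k := by
    rw [add_comm, add_pow]
    refine Finset.sum_congr rfl fun k _ => ?_
    simp; ring
  have h2 : ∑ k ∈ Finset.range (l + 1), (l.choose k : ℝ) * x ^ k
      = ∑ k ∈ Finset.range (l + j + 1), (l.choose k : ℝ) * x ^ k := by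
    refine Finset.sum_subset (Finset.range_mono (by omega)) fun k _ hk => ?_
    rw [Nat.choose_eq_zero_of_lt (by simpa using hk)]; simp
  have h3 : ∑ k ∈ insert 0 (Finset.Icc 1 j), (l.choose k : ℝ) * x ^ k
      ≤ ∑ k ∈ Finset.range (l + j + 1), (l.choose k : ℝ) * x ^ k := by
    refine Finset.sum_le_sum_of_subset_of_nonneg ?_ fun k _ _ => by positivity
    intro k hk
    simp at hk ⊢
    omega
  rw [Finset.sum_insert (by simp)] at h3
  simp only [Nat.choose_zero_right, pow_zero, Nat.cast_one, mul_one] at h3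
  linarith

/-- **Lemma 9 (uniform bound on the `q_{i,j}`).** For an integer `λ ≥ 1` and
`1 ≤ i ≤ j ≤ n`, one has `q_{i,j}(λ) ≤ (2λ−1)ⁿ`. -/
theorem qpoly_bound (lam : ℕ) (hlam : 1 ≤ lam) (n : ℕ) (hn : 1 ≤ n)
    (i j : ℕ) (hi : 1 ≤ i) (hij : i ≤ j) (hjn : j ≤ n) :
    qpoly i j ((lam : ℝ)) ≤ (2 * (lam : ℝ) - 1) ^ n := by
  have hl : (1 : ℝ) ≤ lam := by exact_mod_cast hlam
  set r : ℝ := 2 * (lam : ℝ) - 1 with hr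
  have hr1 : 1 ≤ r := by linarith
  have hr0 : 0 < r := by linarith
  refine le_trans ?_ (pow_le_pow_right₀ hr1 hjn)
  have hx0 : 0 ≤ r⁻¹ := by positivity
  -- Bernoulli: the generating function at `1/r` is at most one
  have hB : (1 + r⁻¹) ^ lam ≤ 2 := by
    have hb := one_add_mul_le_pow (a := -(1 / (2 * (lam : ℝ)))) (by
      have : 1 / (2 * (lam : ℝ)) ≤ 1 := by
        rw [div_le_one (by positivity)]; linarith
      linarith) lam
    have e1 : 1 + (lam : ℝ) * -(1 / (2 * (lam : ℝ))) = 1 / 2 := by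
      field_simp; norm_num
    have e2 : (1 + r⁻¹) * (1 + -(1 / (2 * (lam : ℝ)))) = 1 := by
      have : (lam : ℝ) ≠ 0 := by positivity
      field_simp
      rw [hr]; ring
    have e3 : (1 + r⁻¹) ^ lam * (1 + -(1 / (2 * (lam : ℝ)))) ^ lam = 1 := by
      rw [← mul_pow, e2, one_pow]
    rw [e1] at hb
    have : 0 ≤ (1 + r⁻¹) ^ lam := by positivity
    nlinarith
  have hS := partial_binom_le lam j r⁻¹ hx0
  have hS0 : 0 ≤ ∑ k ∈ Finset.Icc 1 j, (lam.choose k : ℝ) * r⁻¹ ^ k :=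
    Finset.sum_nonneg fun k _ => by positivity
  have key : qpoly i j (lam : ℝ) * r⁻¹ ^ j ≤ 1 := by
    calc qpoly i j (lam : ℝ) * r⁻¹ ^ j
        = ∑ f ∈ (Finset.Nat.antidiagonalTuple i j).filter (fun f => ∀ j, 1 ≤ f j),
            ∏ t, ((lam.choose (f t) : ℝ) * r⁻¹ ^ (f t)) := by
          unfold qpoly
          rw [Finset.sum_mul]
          refine Finset.sum_congr rfl fun f hf => ?_
          have hf' := (Finset.Nat.mem_antidiagonalTuple).1 (Finset.mem_filter.1 hf).1
          rw [Finset.prod_mul_distrib, Finset.prod_pow_eq_pow_sum, hf']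
          simp only [genBinom_nat]
      _ ≤ ∑ f ∈ Fintype.piFinset (fun _ : Fin i => Finset.Icc 1 j),
            ∏ t, ((lam.choose (f t) : ℝ) * r⁻¹ ^ (f t)) := by
          refine Finset.sum_le_sum_of_subset_of_nonneg ?_ fun f _ _ =>
            Finset.prod_nonneg fun t _ => by positivity
          intro f hf
          obtain ⟨h1, h2⟩ := Finset.mem_filter.1 hf
          rw [Finset.Nat.mem_antidiagonalTuple] at h1
          rw [Fintype.mem_piFinset]
          intro t
          rw [Finset.mem_Icc]
          refine ⟨h2 t, ?_⟩
          rw [← h1]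
          exact Finset.single_le_sum (fun _ _ => Nat.zero_le _) (Finset.mem_univ t)
      _ = (∑ k ∈ Finset.Icc 1 j, (lam.choose k : ℝ) * r⁻¹ ^ k) ^ i := by
          rw [← Finset.prod_univ_sum (fun _ : Fin i => Finset.Icc 1 j)
            (fun _ k => (lam.choose k : ℝ) * r⁻¹ ^ k)]
          simp
      _ ≤ 1 := pow_le_one₀ hS0 (by linarith)
  rw [inv_pow, ← div_eq_mul_inv, div_le_one (by positivity)] at key
  exact key

end
end

section
/- Let 𝒜 be a finite alphabet, v = (v_α)_{α∈𝒜} a vector of strictly positive integers, and σ a substitution on 𝒜 such that for every pair of letters α, β ∈ 𝒜 the word σ(α) contains exactly v_β occurrences of β (so all letter images have the same abelianization v). Then every function φ : 𝒜 → ℝ of mean zero (i.e. Σ_α v_α·φ(α) = 0, equivalently ∫ φ dμ = 0) is an infinite coboundary on the subshift (K_{σ,ℤ}, T): there exists a sequence (ψₙ)_{n≥1} of continuous real-valued functions on K_{σ,ℤ} such that φ = ψ₁∘T − ψ₁ and ψₙ = ψ_{n+1}∘T − ψ_{n+1} for every n ≥ 1. -/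
/-- The subshift `K_{σ,ℤ} ⊆ 𝒜^ℤ` of a substitution `σ`: bi-infinite words all of whose
finite factors are factors of some `σⁿ(α)`. -/
def Ksig {A : Type*} (σ : A → List A) : Set (ℤ → A) :=
  { w | ∀ (i : ℤ) (m : ℕ), ∃ (α : A) (n : ℕ),
      (List.ofFn fun j : Fin m => w (i + (j : ℕ))) <:+:
        (fun u : List A => u.flatMap σ)^[n] [α] }

namespace InfCob

/-- substitution acting on one-sided infinite words -/
def sub {A : Type*} (L : ℕ) (s : A → ℕ → A) (x : ℕ → A) (k : ℕ) : A := s (x (k / L)) (k % L)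

/-- partial sums over a block -/
noncomputable def P {A : Type*} (s : A → ℕ → A) (g : A → ℕ → ℝ) (q : ℕ) (β : A) (k : ℕ) : ℝ :=
  ∑ j ∈ Finset.range k, g (s β (j / q)) (j % q)

/-- values of the `p`-th primitive on the block `σ^p(β)` -/
noncomputable def G {A : Type*} [Fintype A] (v : A → ℕ) (L : ℕ) (s : A → ℕ → A) (φ : A → ℝ) :
    ℕ → A → ℕ → ℝ
  | 0 => fun β _ => φ β
  | p + 1 => fun β k => P s (G v L s φ p) (L ^ p) β k -
      (∑ γ, (v γ : ℝ) * ∑ i ∈ Finset.range (L ^ (p + 1)), P s (G v L s φ p) (L ^ p) γ i)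
        / (L : ℝ) ^ (p + 2)

/-- value of the `p`-th primitive on `σ^p(x)` at position `k` -/
noncomputable def val {A : Type*} [Fintype A] (v : A → ℕ) (L : ℕ) (s : A → ℕ → A) (φ : A → ℝ)
    (p : ℕ) (x : ℕ → A) (k : ℕ) : ℝ := G v L s φ p (x (k / L ^ p)) (k % L ^ p)

section
variable {A : Type*} [Fintype A] {v : A → ℕ} {L : ℕ} {s : A → ℕ → A} {φ : A → ℝ}

lemma sum_block (q : ℕ) (n : ℕ) (f : ℕ → ℕ → ℝ) (hq : 0 < q) :
    ∑ j ∈ Finset.range (q * n), f (j / q) (j % q) =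
      ∑ i ∈ Finset.range n, ∑ j ∈ Finset.range q, f i j := by
  induction n with
  | zero => simp
  | succ n ih =>
    rw [Nat.mul_succ, Finset.sum_range_add, ih, Finset.sum_range_succ]
    congr 1
    apply Finset.sum_congr rfl
    intro j hj
    have hj := Finset.mem_range.1 hj
    rw [Nat.mul_add_div hq, Nat.mul_add_mod, Nat.div_eq_of_lt hj, Nat.mod_eq_of_lt hj, add_zero]

lemma G_mean (hL : 0 < L) (hLv : ∑ γ, v γ = L) (hφ : ∑ α : A, (v α : ℝ) * φ α = 0) (p : ℕ) :
    ∑ γ, (v γ : ℝ) * ∑ i ∈ Finset.range (L ^ p), G v L s φ p γ i = 0 := by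
  cases p with
  | zero => simpa [G] using hφ
  | succ p =>
    have h1 : (∑ γ, (v γ : ℝ)) = L := by exact_mod_cast hLv
    have h2 : (L : ℝ) ≠ 0 := by positivity
    simp only [G, Finset.sum_sub_distrib, mul_sub, Finset.sum_const, Finset.card_range,
      nsmul_eq_mul]
    rw [← Finset.sum_mul, h1]
    push_cast
    field_simp
    ring

lemma G_end (hL : 0 < L) (hLv : ∑ γ, v γ = L) (hφ : ∑ α : A, (v α : ℝ) * φ α = 0)
    (hs : ∀ (β : A) (f : A → ℝ), ∑ i ∈ Finset.range L, f (s β i) = ∑ γ, (v γ : ℝ) * f γ)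
    (p : ℕ) (β γ : A) : G v L s φ (p + 1) β (L ^ (p + 1)) = G v L s φ (p + 1) γ 0 := by
  have h : P s (G v L s φ p) (L ^ p) β (L ^ (p + 1)) = 0 := by
    unfold P
    rw [pow_succ, sum_block (L ^ p) L (fun a b => G v L s φ p (s β a) b) (by positivity),
      hs β (fun c => ∑ j ∈ Finset.range (L ^ p), G v L s φ p c j), G_mean hL hLv hφ]
  have h0 : P s (G v L s φ p) (L ^ p) γ 0 = 0 := by simp [P]
  simp only [G, h, h0]

lemma G_step (p : ℕ) (β : A) (k : ℕ) : G v L s φ (p + 1) β (k + 1) - G v L s φ (p + 1) β k =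
    G v L s φ p (s β (k / L ^ p)) (k % L ^ p) := by
  simp only [G, P, Finset.sum_range_succ]; ring

lemma val_step (hL : 0 < L) (hLv : ∑ γ, v γ = L) (hφ : ∑ α : A, (v α : ℝ) * φ α = 0)
    (hs : ∀ (β : A) (f : A → ℝ), ∑ i ∈ Finset.range L, f (s β i) = ∑ γ, (v γ : ℝ) * f γ)
    (p : ℕ) (x : ℕ → A) (k : ℕ) :
    val v L s φ (p + 1) x (k + 1) - val v L s φ (p + 1) x k = val v L s φ p (sub L s x) k := by
  have hq : 0 < L ^ (p + 1) := by positivity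
  have e1 : k % L ^ (p + 1) / L ^ p = k / L ^ p % L := by
    rw [pow_succ, Nat.mod_mul_right_div_self]
  have e2 : k % L ^ (p + 1) % L ^ p = k % L ^ p := by
    rw [pow_succ, Nat.mod_mul_right_mod]
  have e3 : k / L ^ (p + 1) = k / L ^ p / L := by rw [pow_succ, Nat.div_div_eq_div_mul]
  have key : val v L s φ (p + 1) x (k + 1) =
      G v L s φ (p + 1) (x (k / L ^ (p + 1))) (k % L ^ (p + 1) + 1) := by
    unfold val
    have hd := Nat.div_add_mod k (L ^ (p + 1))
    have hm := Nat.mod_lt k hq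
    generalize k / L ^ (p + 1) = a at *
    generalize k % L ^ (p + 1) = b at *
    generalize hQ : L ^ (p + 1) = Q at *
    subst hd
    rcases Nat.lt_or_ge (b + 1) Q with h | h
    · rw [add_assoc, Nat.mul_add_div hq, Nat.mul_add_mod, Nat.div_eq_of_lt h,
        Nat.mod_eq_of_lt h, add_zero]
    · have : b + 1 = Q := by omega
      rw [add_assoc, this, ← Nat.mul_succ, Nat.mul_div_cancel_left _ hq, Nat.mul_mod_right]
      rw [← hQ]
      exact (G_end hL hLv hφ hs p _ _).symm
  rw [key]
  unfold val sub
  rw [G_step, e1, e2, e3]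

lemma val_sum (hL : 0 < L) (hLv : ∑ γ, v γ = L) (hφ : ∑ α : A, (v α : ℝ) * φ α = 0)
    (hs : ∀ (β : A) (f : A → ℝ), ∑ i ∈ Finset.range L, f (s β i) = ∑ γ, (v γ : ℝ) * f γ)
    (p : ℕ) (x : ℕ → A) (k n : ℕ) :
    val v L s φ (p + 1) x (k + n) - val v L s φ (p + 1) x k =
      ∑ j ∈ Finset.range n, val v L s φ p (sub L s x) (k + j) := by
  induction n with
  | zero => simp
  | succ n ih =>
    rw [Finset.sum_range_succ, ← ih, ← val_step hL hLv hφ hs p x (k + n), ← add_assoc]; ring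

lemma occ (hL : 0 < L) (hmem : ∀ β γ : A, ∃ i < L, s β i = γ) (p : ℕ) (y : ℕ → A) (k : ℕ)
    (β : A) (r : ℕ) (hr : r < L ^ p) :
    ∃ n ≤ 2 * L ^ (p + 1), val v L s φ p (sub L s y) (k + n) = G v L s φ p β r := by
  set t := k / L ^ (p + 1) + 1 with ht
  obtain ⟨c, hc, hcβ⟩ := hmem (y t) β
  have hq : 0 < L ^ (p + 1) := by positivity
  have hd := Nat.div_add_mod k (L ^ (p + 1))
  have hm := Nat.mod_lt k hq
  have h1 : L ^ p * c + r < L ^ (p + 1) := by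
    rw [pow_succ]; nlinarith
  have h2 : L ^ p * (L * t + c) + r = L ^ (p + 1) * (k / L ^ (p + 1)) + L ^ (p + 1)
      + (L ^ p * c + r) := by rw [ht, pow_succ]; ring
  have h4 : k ≤ L ^ p * (L * t + c) + r := by linarith [Nat.zero_le (L ^ p * c + r)]
  have h5 : L ^ p * (L * t + c) + r ≤ k + 2 * L ^ (p + 1) := by linarith [Nat.zero_le (k % L ^ (p + 1))]
  refine ⟨L ^ p * (L * t + c) + r - k, Nat.sub_le_iff_le_add'.2 h5, ?_⟩
  have h3 : k + (L ^ p * (L * t + c) + r - k) = L ^ p * (L * t + c) + r :=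
    Nat.add_sub_cancel' h4
  rw [h3]
  unfold val sub
  rw [Nat.mul_add_div (by positivity), Nat.mul_add_mod, Nat.div_eq_of_lt hr, Nat.mod_eq_of_lt hr,
    add_zero, Nat.mul_add_div hL, Nat.mul_add_mod, Nat.div_eq_of_lt hc, Nat.mod_eq_of_lt hc,
    add_zero, hcβ]

lemma exists_max [Nonempty A] (hL : 0 < L) (p : ℕ) : ∃ (β : A) (r : ℕ), r < L ^ p ∧
    ∀ x k, val v L s φ p x k ≤ G v L s φ p β r := by
  have hq : 0 < L ^ p := by positivity
  have : Nonempty (Fin (L ^ p)) := ⟨⟨0, hq⟩⟩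
  obtain ⟨⟨β, r⟩, h⟩ := Finite.exists_max
    (fun z : A × Fin (L ^ p) => G v L s φ p z.1 z.2)
  exact ⟨β, r, r.2, fun x k => h (x (k / L ^ p), ⟨k % L ^ p, Nat.mod_lt _ hq⟩)⟩

lemma determined [Nonempty A] (hL : 0 < L) (hLv : ∑ γ, v γ = L)
    (hφ : ∑ α : A, (v α : ℝ) * φ α = 0)
    (hs : ∀ (β : A) (f : A → ℝ), ∑ i ∈ Finset.range L, f (s β i) = ∑ γ, (v γ : ℝ) * f γ)
    (hmem : ∀ β γ : A, ∃ i < L, s β i = γ) (p : ℕ) :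
    ∃ m : ℕ, ∀ (y y' : ℕ → A) (k k' : ℕ),
      (∀ j < m, (sub L s)^[p + 1] y (k + j) = (sub L s)^[p + 1] y' (k' + j)) →
      val v L s φ p (sub L s y) k = val v L s φ p (sub L s y') k' := by
  induction p with
  | zero =>
    refine ⟨1, fun y y' k k' h => ?_⟩
    have := h 0 one_pos
    simp only [zero_add, Function.iterate_one, add_zero] at this
    simp [val, G, this]
  | succ p ih =>
    obtain ⟨m, hm⟩ := ih
    obtain ⟨β, r, hr, hmax⟩ := exists_max (v := v) (s := s) (φ := φ) hL (p + 1)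
    refine ⟨2 * L ^ (p + 2) + m, ?_⟩
    have key : ∀ (y y' : ℕ → A) (k k' : ℕ),
      (∀ j < 2 * L ^ (p + 2) + m,
        (sub L s)^[p + 2] y (k + j) = (sub L s)^[p + 2] y' (k' + j)) →
      val v L s φ (p + 1) (sub L s y') k' ≤ val v L s φ (p + 1) (sub L s y) k := by
      intro y y' k k' h
      obtain ⟨n, hn, hv⟩ := occ (v := v) (φ := φ) hL hmem (p + 1) y k β r hr
      have e1 := val_sum hL hLv hφ hs p (sub L s y) k n
      have e2 := val_sum hL hLv hφ hs p (sub L s y') k' n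
      have e3 := hmax (sub L s y') (k' + n)
      have e4 : ∑ j ∈ Finset.range n, val v L s φ p (sub L s (sub L s y)) (k + j) =
          ∑ j ∈ Finset.range n, val v L s φ p (sub L s (sub L s y')) (k' + j) := by
        apply Finset.sum_congr rfl
        intro j hj
        have hj := Finset.mem_range.1 hj
        apply hm
        intro i hi
        have := h (j + i) (by have : p + 1 + 1 = p + 2 := rfl
                              rw [this] at hn; omega)
        rw [Function.iterate_succ_apply, Function.iterate_succ_apply] at this
        simpa [add_assoc] using this
      linarith
    intro y y' k k' h
    exact le_antisymm (key _ _ _ _ (fun j hj => (h j hj).symm)) (key _ _ _ _ h)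

end

lemma flatMap_spec {A : Type*} (L : ℕ) (hL : 0 < L) (σ : A → List A) (hlen : ∀ a, (σ a).length = L)
    (u : List A) (x : ℕ → A) (hx : ∀ k < u.length, u[k]? = some (x k)) :
    (u.flatMap σ).length = u.length * L ∧ ∀ k < u.length * L, (u.flatMap σ)[k]? =
      some (sub L (fun a k => (σ a).getD k a) x k) := by
  induction u generalizing x with
  | nil => simp
  | cons a u ih =>
    obtain ⟨h1, h2⟩ := ih (fun k => x (k + 1)) (fun k hk => by
      have := hx (k + 1) (by simpa using hk)
      simpa using this)
    have h0 : a = x 0 := by simpa using hx 0 (by simp)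
    refine ⟨by simp [hlen, h1]; ring, fun k hk => ?_⟩
    rw [List.flatMap_cons]
    rcases Nat.lt_or_ge k L with h | h
    · rw [List.getElem?_append_left (by rw [hlen]; exact h)]
      simp only [sub, Nat.div_eq_of_lt h, Nat.mod_eq_of_lt h, ← h0]
      rw [List.getD_eq_getElem _ _ (by rw [hlen]; exact h), List.getElem?_eq_getElem]
    · rw [List.getElem?_append_right (by rw [hlen]; exact h), hlen]
      obtain ⟨k, rfl⟩ := Nat.exists_eq_add_of_le' h
      have : k < u.length * L := by
        simp only [List.length_cons, add_mul, one_mul] at hk; omega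
      rw [Nat.add_sub_cancel, h2 k this]
      simp only [sub, Nat.add_div_right _ hL, Nat.add_mod_right]

lemma iter_spec {A : Type*} (L : ℕ) (hL : 0 < L) (σ : A → List A) (hlen : ∀ a, (σ a).length = L)
    (α : A) (n : ℕ) :
    ((fun u : List A => u.flatMap σ)^[n] [α]).length = L ^ n ∧ ∀ k < L ^ n,
      ((fun u : List A => u.flatMap σ)^[n] [α])[k]? =
      some ((sub L (fun a k => (σ a).getD k a))^[n] (fun _ => α) k) := by
  induction n with
  | zero => simp
  | succ n ih =>
    rw [Function.iterate_succ_apply', Function.iterate_succ_apply', pow_succ]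
    have := flatMap_spec L hL σ hlen _ _ (by rw [ih.1]; exact ih.2)
    rw [ih.1] at this
    exact this

lemma window {A : Type*} (L : ℕ) (hL : 2 ≤ L) (σ : A → List A) (hlen : ∀ a, (σ a).length = L)
    (w : ℤ → A) (hw : w ∈ Ksig σ) (q m : ℕ) :
    ∃ (y : ℕ → A) (k : ℕ), ∀ j < m, w j = (sub L (fun a k => (σ a).getD k a))^[q] y (k + j) := by
  obtain ⟨α, n, l₁, l₂, h⟩ := hw 0 (m + L ^ q)
  obtain ⟨h1, h2⟩ := iter_spec L (by omega) σ hlen α n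
  rw [← h] at h1 h2
  simp only [List.length_append, List.length_ofFn] at h1
  have hqn : q ≤ n := (Nat.pow_le_pow_iff_right hL).1 (by omega)
  refine ⟨(sub L (fun a k => (σ a).getD k a))^[n - q] (fun _ => α), l₁.length, fun j hj => ?_⟩
  rw [← Function.iterate_add_apply, Nat.add_sub_cancel' hqn]
  have := h2 (l₁.length + j) (by omega)
  rw [List.append_assoc, List.getElem?_append_right (by omega),
    List.getElem?_append_left (by simp; omega)] at this
  rw [Nat.add_sub_cancel_left, List.getElem?_ofFn, dif_pos (by omega)] at this
  simpa using this

end InfCob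

/-- **Theorem 5 (infinite coboundaries).** If every letter image of `σ` has the same
abelianization `v` (with strictly positive entries), then every `φ : 𝒜 → ℝ` of mean
zero is an infinite coboundary on the subshift `(K_{σ,ℤ}, T)`: there are continuous
functions `ψₙ` with `φ = ψ₁∘T − ψ₁` and `ψₙ = ψ_{n+1}∘T − ψ_{n+1}` for all `n ≥ 1`. -/
theorem infinite_coboundary {A : Type*} [Fintype A] [DecidableEq A]
    [TopologicalSpace A] [DiscreteTopology A]
    (v : A → ℕ) (hv : ∀ α : A, 1 ≤ v α)
    (σ : A → List A) (hσ : ∀ α β : A, (σ α).count β = v β)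
    (φ : A → ℝ) (hφ : ∑ α : A, (v α : ℝ) * φ α = 0) :
    ∃ ψ : ℕ → ((ℤ → A) → ℝ),
      (∀ n : ℕ, 1 ≤ n → ContinuousOn (ψ n) (Ksig σ)) ∧
      (∀ w ∈ Ksig σ, φ (w 0) = ψ 1 (fun i => w (i + 1)) - ψ 1 w) ∧
      (∀ n : ℕ, 1 ≤ n → ∀ w ∈ Ksig σ,
        ψ n w = ψ (n + 1) (fun i => w (i + 1)) - ψ (n + 1) w) := by
  classical
  by_cases hA : IsEmpty A
  · exact ⟨fun _ _ => 0, fun _ _ => continuousOn_const, fun w _ => hA.elim (w 0),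
      fun _ _ w _ => hA.elim (w 0)⟩
  have : Nonempty A := not_isEmpty_iff.1 hA
  obtain ⟨L, hLv⟩ : ∃ L, ∑ γ, v γ = L := ⟨_, rfl⟩
  have hcard : Fintype.card A ≤ L := by
    rw [← hLv, Fintype.card_eq_sum_ones]; exact Finset.sum_le_sum (fun a _ => hv a)
  rcases Nat.lt_or_ge L 2 with hL | hL
  · have : Subsingleton A := Fintype.card_le_one_iff_subsingleton.1 (by omega)
    have hz : ∀ a, φ a = 0 := by
      intro a
      rw [Fintype.sum_subsingleton _ a] at hφ
      have := hv a
      rcases mul_eq_zero.1 hφ with h | h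
      · have : v a = 0 := by exact_mod_cast h
        omega
      · exact h
    exact ⟨fun _ _ => 0, fun _ _ => continuousOn_const, fun w _ => by simp [hz],
      fun _ _ w _ => by simp⟩
  have hL0 : 0 < L := by omega
  have hlen : ∀ a, (σ a).length = L := by
    intro a
    rw [← hLv, ← Multiset.coe_card, ← Multiset.sum_count_eq_card (s := Finset.univ) (by simp)]
    exact Finset.sum_congr rfl (fun b _ => by simp [hσ])
  set s : A → ℕ → A := fun a k => (σ a).getD k a with hsdef
  have hs : ∀ (β : A) (f : A → ℝ),
      ∑ i ∈ Finset.range L, f (s β i) = ∑ γ, (v γ : ℝ) * f γ := by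
    intro β f
    have h1 : ((σ β).map f).sum = ∑ γ, (v γ : ℝ) * f γ := by
      rw [Finset.sum_list_map_count, Finset.sum_subset (Finset.subset_univ _)]
      · exact Finset.sum_congr rfl (fun b _ => by simp [hσ])
      · intro b _ hb
        rw [List.mem_toFinset] at hb
        simp [List.count_eq_zero_of_not_mem hb]
    rw [← h1, ← hlen β, Finset.sum_range, ← Fin.sum_univ_fun_getElem]
    exact Finset.sum_congr rfl (fun i _ => by simp [hsdef])
  have hmem : ∀ β γ : A, ∃ i < L, s β i = γ := by
    intro β γ
    have : γ ∈ σ β := by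
      rw [← List.count_pos_iff, hσ]; exact hv γ
    obtain ⟨i, hi, h⟩ := List.getElem_of_mem this
    exact ⟨i, by rw [← hlen β]; exact hi, by simp [hsdef, hi, h]⟩
  have hdet := InfCob.determined hL0 hLv hφ hs hmem
  choose m hm using hdet
  let g : (p : ℕ) → (Fin (m p) → A) → ℝ := fun p u =>
    if h : ∃ z : (ℕ → A) × ℕ, ∀ j : Fin (m p), u j = (InfCob.sub L s)^[p + 1] z.1 (z.2 + j) then
      InfCob.val v L s φ p (InfCob.sub L s h.choose.1) h.choose.2 else 0
  let ψ : ℕ → (ℤ → A) → ℝ := fun p w => g p (fun j => w ((j : ℕ) : ℤ))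
  have hψ : ∀ p w y k, (∀ j < m p, w ((j : ℕ) : ℤ) = (InfCob.sub L s)^[p + 1] y (k + j)) →
      ψ p w = InfCob.val v L s φ p (InfCob.sub L s y) k := by
    intro p w y k h
    have hex : ∃ z : (ℕ → A) × ℕ, ∀ j : Fin (m p),
        w ((j : ℕ) : ℤ) = (InfCob.sub L s)^[p + 1] z.1 (z.2 + j) :=
      ⟨(y, k), fun j => h j j.2⟩
    change g p _ = _
    simp only [g]
    rw [dif_pos hex]
    apply hm
    intro j hj
    rw [← h j hj]
    exact (hex.choose_spec ⟨j, hj⟩).symm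
  have hstep : ∀ p, ∀ w ∈ Ksig σ, ψ p w = ψ (p + 1) (fun i => w (i + 1)) - ψ (p + 1) w := by
    intro p w hw
    obtain ⟨y, k, h⟩ := InfCob.window L hL σ hlen w hw (p + 2) (m p + m (p + 1) + 1)
    rw [hψ p w (InfCob.sub L s y) k (fun j hj => h j (by omega)),
      hψ (p + 1) w y k (fun j hj => h j (by omega)),
      hψ (p + 1) (fun i => w (i + 1)) y (k + 1) (fun j hj => by
        have := h (j + 1) (by omega)
        push_cast at this
        rw [this, add_assoc k 1 j, add_comm 1 j])]
    exact (InfCob.val_step hL0 hLv hφ hs p _ k).symm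
  refine ⟨ψ, fun n _ => ?_, fun w hw => ?_, fun n _ w hw => hstep n w hw⟩
  · apply Continuous.continuousOn
    have : Continuous (g n) := continuous_of_discreteTopology
    exact this.comp (continuous_pi fun j => continuous_apply _)
  · rw [← hstep 0 w hw]
    obtain ⟨y, k, h⟩ := InfCob.window L hL σ hlen w hw 1 (m 0 + 1)
    rw [hψ 0 w y k (fun j hj => h j (by omega))]
    have := h 0 (by omega)
    simp only [Function.iterate_one, add_zero, Nat.cast_zero] at this
    simp only [InfCob.val, InfCob.G, pow_zero, Nat.div_one]
    rw [this]
end
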